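/- Let f₂(x) = (x² − x − 1)⁵·(x² − x − 1/16) − (25/2)·x³·(x − 1)³·(x³ − 2) ∈ ℚ[x]. Then f₂ is irreducible over ℚ, the Galois group of its splitting field over ℚ is a simple group of cardinality 7920 (i.e., isomorphic to the Mathieu group M₁₁), and the root field K = ℚ[x]/(f₂) is a degree-12 number field with discriminant 2⁸·3¹⁶·5¹⁰·7⁴. -/

import Mathlib

open Polynomial

/-- `f₂(x) = (x² − x − 1)⁵ (x² − x − 1/16) − (25/2) · x³ (x − 1)³ (x³ − 2)` over `ℚ`. -/
noncomputable def f2 : Polynomial ℚ :=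
  (X ^ 2 - X - 1) ^ 5 * (X ^ 2 - X - C (1 / 16 : ℚ)) -
    C (25 / 2 : ℚ) * (X ^ 3 * (X - 1) ^ 3 * (X ^ 3 - 2))

namespace M11

/-- evaluation of an integer coefficient list (low degree first) -/
def ev {R : Type*} [CommRing R] (x : R) : List ℤ → R
  | [] => 0
  | c :: l => (c : R) + x * ev x l

def ladd : List ℤ → List ℤ → List ℤ
  | [], b => b
  | a :: l, [] => a :: l
  | a :: l, b :: m => (a + b) :: ladd l m

def lsc (c : ℤ) : List ℤ → List ℤ
  | [] => []
  | a :: l => (c * a) :: lsc c l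

def lmul : List ℤ → List ℤ → List ℤ
  | [], _ => []
  | a :: l, b => ladd (lsc a b) (0 :: lmul l b)

/-- split off the coefficient of degree `n` (if present) of a list of length at most `n+1` -/
def ltop : ℕ → List ℤ → List ℤ × ℤ
  | _, [] => ([], 0)
  | 0, a :: _ => ([], a)
  | n + 1, a :: l => (a :: (ltop n l).1, (ltop n l).2)

/-- remainder modulo the monic polynomial `X ^ n + t` -/
def lrem (n : ℕ) (t : List ℤ) : List ℤ → List ℤ
  | [] => []
  | c :: l => ladd (ltop n (c :: lrem n t l)).1 (lsc (-(ltop n (c :: lrem n t l)).2) t)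

def lmod (p : ℤ) : List ℤ → List ℤ
  | [] => []
  | a :: l => (a % p) :: lmod p l

/-- all coefficients divisible by `p` -/
def lzero (p : ℤ) : List ℤ → Bool
  | [] => true
  | a :: l => (a % p == 0) && lzero p l

section
variable {R : Type*} [CommRing R] (x : R)

theorem ev_add (a b : List ℤ) : ev x (ladd a b) = ev x a + ev x b := by
  induction a generalizing b with
  | nil => simp [ladd, ev]
  | cons c l ih =>
    cases b with
    | nil => simp [ladd, ev]
    | cons d m => simp [ladd, ev, ih]; ring

theorem ev_sc (c : ℤ) (a : List ℤ) : ev x (lsc c a) = c * ev x a := by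
  induction a with
  | nil => simp [lsc, ev]
  | cons d l ih => simp [lsc, ev, ih]; ring

theorem ev_mul (a b : List ℤ) : ev x (lmul a b) = ev x a * ev x b := by
  induction a with
  | nil => simp [lmul, ev]
  | cons d l ih => simp [lmul, ev, ev_add, ev_sc, ih]; ring

theorem lsc_length (c : ℤ) (a : List ℤ) : (lsc c a).length = a.length := by
  induction a with
  | nil => rfl
  | cons d l ih => simp [lsc, ih]

theorem ladd_length (a b : List ℤ) : (ladd a b).length = max a.length b.length := by
  induction a generalizing b with
  | nil => simp [ladd]
  | cons c l ih =>
    cases b with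
    | nil => simp [ladd]
    | cons d m => simp [ladd, ih]

theorem ltop_length (n : ℕ) (a : List ℤ) : (ltop n a).1.length ≤ n := by
  induction a generalizing n with
  | nil => simp [ltop]
  | cons c l ih =>
    cases n with
    | zero => simp [ltop]
    | succ n => simp [ltop, ih]

theorem ltop_ev (n : ℕ) (a : List ℤ) (h : a.length ≤ n + 1) :
    ev x a = ev x (ltop n a).1 + x ^ n * (ltop n a).2 := by
  induction a generalizing n with
  | nil => simp [ltop, ev]
  | cons c l ih =>
    cases n with
    | zero =>
      have : l = [] := by
        cases l with
        | nil => rfl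
        | cons d m => simp at h
      subst this
      simp [ltop, ev]
    | succ n =>
      have := ih n (by simpa using h)
      simp only [ltop, ev]
      rw [this]; ring

theorem lrem_length (n : ℕ) (t : List ℤ) (ht : t.length ≤ n) (a : List ℤ) :
    (lrem n t a).length ≤ n := by
  induction a with
  | nil => simp [lrem]
  | cons c l ih =>
    simp only [lrem, ladd_length, lsc_length]
    exact max_le (ltop_length _ _) ht

theorem ev_rem (n : ℕ) (t : List ℤ) (ht : t.length ≤ n) (hx : x ^ n + ev x t = 0) (a : List ℤ) :
    ev x (lrem n t a) = ev x a := by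
  induction a with
  | nil => simp [lrem]
  | cons c l ih =>
    simp only [lrem, ev_add, ev_sc]
    have h := ltop_ev x n (c :: lrem n t l) (by simpa using lrem_length n t ht l)
    have h2 : ev x (c :: l) = ev x (c :: lrem n t l) := by simp [ev, ih]
    rw [h2, h]
    push_cast
    linear_combination -((ltop n (c :: lrem n t l)).2 : R) * hx

theorem ev_mod (p : ℤ) (hp : (p : R) = 0) (a : List ℤ) : ev x (lmod p a) = ev x a := by
  induction a with
  | nil => simp [lmod]
  | cons c l ih =>
    simp only [lmod, ev, ih]
    have : ((c % p : ℤ) : R) = c := by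
      conv_rhs => rw [← Int.emod_add_mul_ediv c p]
      push_cast; rw [hp]; ring
    rw [this]

theorem ev_zero (p : ℤ) (hp : (p : R) = 0) (a : List ℤ) (h : lzero p a = true) : ev x a = 0 := by
  induction a with
  | nil => simp [ev]
  | cons c l ih =>
    simp only [lzero, Bool.and_eq_true, beq_iff_eq] at h
    simp only [ev, ih h.2]
    obtain ⟨k, hk⟩ := Int.dvd_of_emod_eq_zero h.1
    rw [hk]; push_cast; rw [hp]; ring

theorem map_ev {S F : Type*} [CommRing S] [FunLike F R S] [RingHomClass F R S] (f : F)
    (a : List ℤ) : f (ev x a) = ev (f x) a := by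
  induction a with
  | nil => simp [ev]
  | cons c l ih => simp [ev, ih]

theorem ev_append (a b : List ℤ) : ev x (a ++ b) = ev x a + x ^ a.length * ev x b := by
  induction a with
  | nil => simp [ev]
  | cons c l ih => simp [ev, ih]; ring

end

theorem ev_X_degree {R : Type*} [CommRing R] [Nontrivial R] (a : List ℤ) :
    (ev (X : R[X]) a).degree < (a.length : ℕ) ∨ a = [] := by
  induction a with
  | nil => simp
  | cons c l ih =>
    left
    have h1 : (ev (X : R[X]) l).degree < (l.length : ℕ) := by
      rcases ih with h | h
      · exact h
      · subst h; simp [ev]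
    simp only [ev, List.length_cons]
    refine lt_of_le_of_lt (degree_add_le _ _) (max_lt ?_ ?_)
    · refine lt_of_le_of_lt (b := 0) ?_ (by exact_mod_cast Nat.succ_pos _)
      have : ((c : R[X])) = C (c : R) := by simp
      rw [this]; exact degree_C_le
    · rw [mul_comm, degree_mul_X]
      push_cast
      exact (WithBot.add_lt_add_iff_right (by simp)).2 h1

/-- monic polynomial `X ^ n + t` -/
theorem ev_monic {R : Type*} [CommRing R] [Nontrivial R] (t : List ℤ) :
    (ev (X : R[X]) (t ++ [1])).Monic ∧ (ev (X : R[X]) (t ++ [1])).natDegree = t.length := by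
  have h1 : ev (X : R[X]) (t ++ [1]) = X ^ t.length + ev (X : R[X]) t := by
    rw [ev_append]; simp [ev]; ring
  have h2 : (ev (X : R[X]) t).degree < (t.length : ℕ) := by
    rcases ev_X_degree (R := R) t with h | h
    · exact h
    · subst h; simp [ev]
  rw [h1]
  refine ⟨monic_X_pow_add h2, ?_⟩
  refine natDegree_eq_of_degree_eq_some ?_
  rw [degree_add_eq_left_of_degree_lt (by rwa [degree_X_pow]), degree_X_pow]

end M11

namespace M11

def bval : List Bool → ℕ
  | [] => 0
  | b :: l => (if b then 1 else 0) + 2 * bval l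

/-- multiplication modulo `p` and `X^n+t` -/
def lmm (p : ℤ) (n : ℕ) (t a b : List ℤ) : List ℤ := lmod p (lrem n t (lmod p (lmul a b)))

def lpw (p : ℤ) (n : ℕ) (t a : List ℤ) : List Bool → List ℤ
  | [] => [1]
  | true :: l => lmm p n t a (lmm p n t (lpw p n t a l) (lpw p n t a l))
  | false :: l => lmm p n t (lpw p n t a l) (lpw p n t a l)

def lfr (p : ℤ) (n : ℕ) (t : List ℤ) (q : List Bool) : ℕ → List ℤ
  | 0 => [0, 1]
  | k + 1 => lpw p n t (lfr p n t q k) q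

section
variable {R : Type*} [CommRing R] (x : R)

theorem ev_mm (p : ℤ) (hp : (p : R) = 0) (n : ℕ) (t : List ℤ) (ht : t.length ≤ n)
    (hx : x ^ n + ev x t = 0) (a b : List ℤ) : ev x (lmm p n t a b) = ev x a * ev x b := by
  rw [lmm, ev_mod x p hp, ev_rem x n t ht hx, ev_mod x p hp, ev_mul]

theorem ev_pw (p : ℤ) (hp : (p : R) = 0) (n : ℕ) (t : List ℤ) (ht : t.length ≤ n)
    (hx : x ^ n + ev x t = 0) (a : List ℤ) (l : List Bool) :
    ev x (lpw p n t a l) = ev x a ^ bval l := by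
  induction l with
  | nil => simp [lpw, ev, bval]
  | cons b l ih =>
    cases b
    · rw [lpw, ev_mm x p hp n t ht hx, ih, bval, if_neg (by simp)]; ring
    · rw [lpw, ev_mm x p hp n t ht hx, ev_mm x p hp n t ht hx, ih, bval, if_pos rfl]; ring

theorem ev_fr (p : ℤ) (hp : (p : R) = 0) (n : ℕ) (t : List ℤ) (ht : t.length ≤ n)
    (hx : x ^ n + ev x t = 0) (q : List Bool) (k : ℕ) :
    ev x (lfr p n t q k) = x ^ (bval q ^ k) := by
  induction k with
  | zero => simp [lfr, ev]
  | succ k ih => rw [lfr, ev_pw x p hp n t ht hx, ih, ← pow_mul, pow_succ]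

end

/-- the data certifying that all roots of `X^n+t` mod `p` have degree divisible by `l^(e+1)` -/
structure Cert (p l e : ℕ) (q : List Bool) (t u : List ℤ) : Prop where
  hq : bval q = p
  h1 : lzero p (ladd (lfr p t.length t q (l ^ (e + 1))) [0, -1]) = true
  h2 : lzero p (ladd (lmm p t.length t u (ladd (lfr p t.length t q (l ^ e)) [0, -1])) [-1]) = true

theorem Cert.dvd {p l e : ℕ} {q : List Bool} {t u : List ℤ} (H : Cert p l e q t u)
    (hl : l.Prime) {k : Type*} [Field k] [Finite k] (hp : (p : k) = 0) (f : ℕ)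
    (hf : Nat.card k = p ^ f) (a : k) (ha : ev a (t ++ [1]) = 0) : l ^ (e + 1) ∣ f := by
  have hp' : ((p : ℤ) : k) = 0 := by simpa using hp
  have ha' : a ^ t.length + ev a t = 0 := by
    rw [ev_append] at ha; simp [ev] at ha; linear_combination ha
  have hit : ∀ n, (fun y : k => y ^ p)^[n] a = a ^ p ^ n := fun n => by
    induction n with
    | zero => simp
    | succ n ih => rw [Function.iterate_succ_apply', ih, ← pow_mul, pow_succ]
  have h1 : Function.IsPeriodicPt (fun y : k => y ^ p) (l ^ (e + 1)) a := by
    have := ev_zero a p hp' _ H.h1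
    rw [ev_add, ev_fr a p hp' _ t le_rfl ha' , H.hq] at this
    simp [ev] at this
    rw [Function.IsPeriodicPt, Function.IsFixedPt, hit]; linear_combination this
  have h2 : ¬ Function.IsPeriodicPt (fun y : k => y ^ p) (l ^ e) a := by
    intro h
    rw [Function.IsPeriodicPt, Function.IsFixedPt, hit] at h
    have := ev_zero a p hp' _ H.h2
    rw [ev_add, ev_mm a p hp' _ t le_rfl ha', ev_add, ev_fr a p hp' _ t le_rfl ha' , H.hq, h] at this
    simp [ev] at this
  have : Fact l.Prime := ⟨hl⟩
  rw [← Function.minimalPeriod_eq_prime_pow h2 h1, ← Function.isPeriodicPt_iff_minimalPeriod_dvd,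
    Function.IsPeriodicPt, Function.IsFixedPt, hit, ← hf]
  have := Fintype.ofFinite k
  rw [Nat.card_eq_fintype_card]; exact FiniteField.pow_card a

def F0 : List ℤ := [16,-96,159,-115,195,-546,1031,-1269,945,-410,69,21,1]
def FT : List ℤ := [-3673,-1623,37836,-49905,25320,-7149,2826,-1197,270,-55,12,-3,1]

def b47 : List Bool := [true, true, true, true, false, true]
def b23 : List Bool := [true, true, true, false, true]
def h47 : List ℤ := [9, 32, 45, 4, 34, 38, 21, 44, 28, 18, 14]
def h23 : List ℤ := [6, 9, 18, 13, 2, 6, 9, 21]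
def k47 : List ℤ := [23, 10, 43, 11, 5, 6, 0, 32, 17, 15, 30]

theorem cert47 : Cert 47 11 0 b47 h47 [35, 21, 6, 42, 13, 15, 12, 3, 18, 42, 26] :=
  ⟨rfl, by decide +kernel, by decide +kernel⟩
theorem cert23 : Cert 23 2 2 b23 h23 [19, 22, 3, 10, 7, 16, 1, 18] :=
  ⟨rfl, by decide +kernel, by decide +kernel⟩
theorem cert47T : Cert 47 11 0 b47 k47 [11, 42, 29, 42, 2, 4, 46, 34, 10, 45, 2] :=
  ⟨rfl, by decide +kernel, by decide +kernel⟩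
end M11

namespace M11

theorem Cert.irr {p l : ℕ} [hp : Fact p.Prime] {q : List Bool} {t u : List ℤ}
    (H : Cert p l 0 q t u) (hl : l.Prime) (ht : t.length = l) :
    Irreducible (ev (X : (ZMod p)[X]) (t ++ [1])) := by
  obtain ⟨hm, hd⟩ := ev_monic (R := ZMod p) t
  have hne : ¬ IsUnit (ev (X : (ZMod p)[X]) (t ++ [1])) := by
    intro h
    have := natDegree_eq_zero_of_isUnit h
    rw [hd, ht] at this; exact hl.ne_zero this
  obtain ⟨g, hgi, hg⟩ := WfDvdMonoid.exists_irreducible_factor hne hm.ne_zero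
  have := Fact.mk hgi
  have hfin : FiniteDimensional (ZMod p) (AdjoinRoot g) := (AdjoinRoot.powerBasis hgi.ne_zero).finite
  have hfin2 : Finite (AdjoinRoot g) := Module.finite_of_finite (ZMod p)
  have hcard : Nat.card (AdjoinRoot g) = p ^ g.natDegree := by
    rw [Module.natCard_eq_pow_finrank (K := ZMod p), (AdjoinRoot.powerBasis hgi.ne_zero).finrank]
    simp
  have h0 : ((p : AdjoinRoot g)) = 0 := by
    have : ((p : ZMod p)) = 0 := by simp
    have h2 := congrArg (algebraMap (ZMod p) (AdjoinRoot g)) this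
    rwa [map_natCast, map_zero] at h2
  have hr : ev (AdjoinRoot.root g) (t ++ [1]) = 0 := by
    obtain ⟨c, hc⟩ := hg
    have := congrArg (AdjoinRoot.mk g) hc
    rw [map_mul, AdjoinRoot.mk_self, zero_mul, map_ev, AdjoinRoot.mk_X] at this
    exact this
  have h1 := H.dvd hl h0 g.natDegree hcard _ hr
  have h2 : l ≤ g.natDegree := by
    refine Nat.le_of_dvd ?_ (by simpa using h1)
    exact hgi.natDegree_pos
  have h3 : Associated g (ev (X : (ZMod p)[X]) (t ++ [1])) := by
    apply associated_of_dvd_of_natDegree_le hg hm.ne_zero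
    rw [hd, ht]; exact h2
  exact h3.irreducible hgi

theorem ev_list_monic {R : Type*} [CommRing R] [Nontrivial R] (F t : List ℤ) (h : F = t ++ [1]) :
    (ev (X : R[X]) F).Monic ∧ (ev (X : R[X]) F).natDegree = t.length := by
  subst h; exact ev_monic t

theorem irr_of {l : ℕ} (F t h c : List ℤ) (hF : F = t ++ [1]) (ht : t.length = l + 1)
    {p : ℕ} [hp : Fact p.Prime] {q : List Bool} {u : List ℤ}
    (H : Cert p l 0 q h u) (hl : l.Prime) (hh : h.length = l)
    (hmul : lzero p (ladd (lmul (h ++ [1]) c) (lsc (-1) F)) = true)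
    (h3 : ∀ x : ZMod 3, ev x F ≠ 0) : Irreducible (ev (X : ℤ[X]) F) := by
  obtain ⟨hm, hd⟩ := ev_list_monic (R := ℤ) F t hF
  have hirr := H.irr hl hh
  have hdvd : ev (X : (ZMod p)[X]) (h ++ [1]) ∣ ev (X : (ZMod p)[X]) F := by
    have := ev_zero (X : (ZMod p)[X]) p (by simp) _ hmul
    rw [ev_add, ev_mul, ev_sc] at this
    refine ⟨ev X c, ?_⟩
    push_cast at this
    linear_combination -this
  rw [hm.irreducible_iff_natDegree']
  refine ⟨by intro h; rw [h] at hd; simp at hd; omega, ?_⟩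
  rintro f g hf hg hfg hgd
  rw [hd, ht, Finset.mem_Ioc] at hgd
  have hsum : f.natDegree + g.natDegree = l + 1 := by
    rw [← hf.natDegree_mul hg, hfg, hd, ht]
  have hmap : f.map (Int.castRingHom (ZMod p)) * g.map (Int.castRingHom (ZMod p))
      = ev (X : (ZMod p)[X]) F := by
    rw [← Polynomial.map_mul, hfg]
    have := map_ev (X : ℤ[X]) (Polynomial.mapRingHom (Int.castRingHom (ZMod p))) F
    simpa using this
  rw [← hmap] at hdvd
  have hl2 := hl.two_le
  have hdeg : (ev (X : (ZMod p)[X]) (h ++ [1])).natDegree = l := by rw [(ev_monic h).2, hh]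
  rcases hirr.prime.dvd_or_dvd hdvd with h1 | h1
  · have h2 := natDegree_le_of_dvd h1 (hf.map _).ne_zero
    rw [hdeg, hf.natDegree_map] at h2
    have hg1 : g.natDegree = 1 := by omega
    have hgr : g.IsRoot (-(g.coeff 0)) := by
      have := hg.eq_X_add_C hg1
      rw [this]; simp
    have hFr : ev (-(g.coeff 0)) F = 0 := by
      have := congrArg (eval (-(g.coeff 0))) hfg
      rw [eval_mul, hgr.eq_zero, mul_zero, ← coe_evalRingHom, map_ev] at this
      simpa using this.symm
    have := congrArg (Int.castRingHom (ZMod 3)) hFr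
    rw [map_ev, map_zero] at this
    exact h3 _ this
  · have h2 := natDegree_le_of_dvd h1 (hg.map _).ne_zero
    rw [hdeg, hg.natDegree_map] at h2
    have : (l + 1) / 2 < l := by have := hl.two_le; omega
    omega

theorem irrF0 : Irreducible (ev (X : ℤ[X]) F0) := by
  have : Fact (Nat.Prime 47) := ⟨by norm_num⟩
  exact irr_of F0 [16,-96,159,-115,195,-546,1031,-1269,945,-410,69,21] h47 [7, 1] rfl rfl cert47
    (by norm_num) rfl (by decide +kernel) (by decide +kernel)

theorem irrFT : Irreducible (ev (X : ℤ[X]) FT) := by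
  have : Fact (Nat.Prime 47) := ⟨by norm_num⟩
  exact irr_of FT [-3673,-1623,37836,-49905,25320,-7149,2826,-1197,270,-55,12,-3] k47 [14, 1]
    rfl rfl cert47T (by norm_num) rfl (by decide +kernel) (by decide +kernel)

open NumberField in
theorem Cert.dvd_card {p l e : ℕ} {q : List Bool} {t u : List ℤ} (H : Cert p l e q t u)
    (hl : l.Prime) (hp : p.Prime) (ht : t ≠ []) (F s c : List ℤ) (hF : F = s ++ [1])
    (hmul : lzero p (ladd (lmul (t ++ [1]) c) (lsc (-1) F)) = true)
    (L : Type) [Field L] [NumberField L] [IsGalois ℚ L]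
    (hs : (ev (X : L[X]) F).Splits) : l ^ (e + 1) ∣ Nat.card Gal(L/ℚ) := by
  obtain ⟨hm, hd⟩ := ev_list_monic (R := 𝓞 L) F s hF
  have hpz : Prime (p : ℤ) := Nat.prime_iff_prime_int.1 hp
  have hPp : (Ideal.span {(p : ℤ)}).IsPrime :=
    (Ideal.span_singleton_prime hpz.ne_zero).2 hpz
  obtain ⟨⟨P, hP1, hP2⟩⟩ := (Ideal.span {(p : ℤ)}).nonempty_primesOver (S := 𝓞 L)
  have hsO : (ev (X : (𝓞 L)[X]) F).Splits := by
    have hmap : (ev (X : (𝓞 L)[X]) F).map (algebraMap (𝓞 L) L) = ev (X : L[X]) F := by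
      have := map_ev (X : (𝓞 L)[X]) (Polynomial.mapRingHom (algebraMap (𝓞 L) L)) F
      simpa using this
    refine Splits.of_splits_map_of_injective (i := algebraMap (𝓞 L) L)
      (FaithfulSMul.algebraMap_injective _ _) (by rwa [hmap]) ?_
    intro a ha
    have hint : IsIntegral ℤ a := by
      refine ⟨ev (X : ℤ[X]) F, (ev_list_monic F s hF).1, ?_⟩
      have := (mem_roots'.1 ha).2
      rw [hmap, IsRoot, ← coe_evalRingHom, map_ev] at this
      have h2 := map_ev (X : ℤ[X]) (Polynomial.eval₂RingHom (algebraMap ℤ L) a) F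
      simp only [coe_evalRingHom, eval_X] at this
      simpa [this] using h2
    exact ⟨⟨a, hint⟩, rfl⟩
  have hP0 : P ≠ ⊥ := Ideal.ne_bot_of_liesOver_of_ne_bot
    (p := Ideal.span {(p : ℤ)}) (by simpa using hp.ne_zero) P
  have hPm : P.IsMaximal := hP1.isMaximal hP0
  let : Field (𝓞 L ⧸ P) := Ideal.Quotient.field P
  have : Finite (𝓞 L ⧸ P) := Ideal.finiteQuotientOfFreeOfNeBot P hP0
  have hp0 : ((p : 𝓞 L ⧸ P)) = 0 := by
    have h1 : (p : 𝓞 L) ∈ P := by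
      have : (p : ℤ) ∈ P.under ℤ := by
        rw [← hP2.over]; exact Ideal.mem_span_singleton_self _
      simpa [Ideal.mem_comap] using this
    have := Ideal.Quotient.eq_zero_iff_mem.2 h1
    simpa using this
  have hsk : (ev (X : (𝓞 L ⧸ P)[X]) F).Splits := by
    have := hsO.map (Ideal.Quotient.mk P)
    have h2 := map_ev (X : (𝓞 L)[X]) (Polynomial.mapRingHom (Ideal.Quotient.mk P)) F
    simp only [coe_mapRingHom, map_X] at h2
    rwa [h2] at this
  have hdvd : ev (X : (𝓞 L ⧸ P)[X]) (t ++ [1]) ∣ ev (X : (𝓞 L ⧸ P)[X]) F := by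
    have hp0' : (((p : ℤ)) : (𝓞 L ⧸ P)[X]) = 0 := by
      have := congrArg (C : _ → (𝓞 L ⧸ P)[X]) hp0
      simpa using this
    have := ev_zero (X : (𝓞 L ⧸ P)[X]) p hp0' _ hmul
    rw [ev_add, ev_mul, ev_sc] at this
    refine ⟨ev X c, ?_⟩
    push_cast at this
    linear_combination -this
  have hst := hsk.of_dvd (ev_list_monic F s hF).1.ne_zero hdvd
  obtain ⟨a, ha⟩ := hst.exists_eval_eq_zero (by
    rw [degree_eq_natDegree (ev_monic t).1.ne_zero, (ev_monic t).2]
    simpa using ht)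
  rw [← coe_evalRingHom, map_ev] at ha
  simp only [coe_evalRingHom, eval_X] at ha
  have hf : Nat.card (𝓞 L ⧸ P) = p ^ P.inertiaDeg ℤ := by
    rw [Ideal.pow_inertiaDeg p P]; rfl
  have h1 := H.dvd hl hp0 _ hf a ha
  refine h1.trans ?_
  rw [← Ideal.ncard_primesOver_mul_ramificationIdxIn_mul_inertiaDegIn (Ideal.span {(p : ℤ)}) (𝓞 L)
    Gal(L/ℚ), Ideal.inertiaDegIn_eq_inertiaDeg (Ideal.span {(p : ℤ)}) P Gal(L/ℚ), ← mul_assoc]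
  exact Dvd.intro_left _ rfl

theorem dvd_card (L : Type) [Field L] [NumberField L] [IsGalois ℚ L]
    (hs : (ev (X : L[X]) F0).Splits) : 11 ∣ Nat.card Gal(L/ℚ) ∧ 8 ∣ Nat.card Gal(L/ℚ) := by
  constructor
  · have := cert47.dvd_card (by norm_num) (by norm_num) (by simp [h47]) F0
      [16,-96,159,-115,195,-546,1031,-1269,945,-410,69,21] [7, 1] rfl (by decide +kernel) L hs
    simpa using this
  · have := cert23.dvd_card (by norm_num) (by norm_num) (by simp [h23]) F0
      [16,-96,159,-115,195,-546,1031,-1269,945,-410,69,21] [18, 3, 14, 0, 1] rfl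
      (by decide +kernel) L hs
    simpa using this
end M11

namespace M11
open Equiv

abbrev Om := Option (ZMod 11)

def sg : Perm Om := Equiv.optionCongr (Equiv.addRight (1 : ZMod 11))

def blk (k : ZMod 11) : Om → Bool
  | none => true
  | some x => Nat.testBit 570 ((x.val + 11 - k.val) % 11)

def qq (a b c d : Om) : ℕ :=
  (Finset.univ.filter fun k : ZMod 11 => (blk k a == blk k b && (blk k b == blk k c &&
    blk k c == blk k d)) = true).card

@[simp] theorem sg_none : sg none = none := rfl
@[simp] theorem sg_some (x : ZMod 11) : sg (some x) = some (x + 1) := rfl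
theorem sg_pow_none (n : ℕ) : (sg ^ n) none = none := by
  induction n with
  | zero => rfl
  | succ n ih => rw [pow_succ', Perm.mul_apply, ih, sg_none]
theorem sg_pow_some (n : ℕ) (x : ZMod 11) : (sg ^ n) (some x) = some (x + n) := by
  induction n with
  | zero => simp
  | succ n ih => rw [pow_succ', Perm.mul_apply, ih, sg_some]; push_cast; rw [add_assoc]

theorem sg_order : orderOf sg = 11 := by
  have : Fact (Nat.Prime 11) := ⟨by norm_num⟩
  apply orderOf_eq_prime
  · ext1 x
    cases x with
    | none => exact sg_pow_none 11
    | some x => rw [sg_pow_some]; simp; exact CharP.cast_eq_zero (ZMod 11) 11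
  · intro h
    have := congrArg (fun g : Perm Om => g (some 0)) h
    simp at this

theorem sg_fix {x : Om} (h : sg x = x) : x = none := by
  cases x with
  | none => rfl
  | some x => simp at h; exact absurd h (by decide)

theorem sg_zpow_none (n : ℤ) : (sg ^ n) none = none := by
  have h : (sg⁻¹) none = none := by rw [Perm.inv_eq_iff_eq]; rfl
  cases n with
  | ofNat n => exact sg_pow_none n
  | negSucc n => rw [zpow_negSucc, Perm.inv_eq_iff_eq, sg_pow_none]

/-- Lemma R -/
theorem lemR (K : Subgroup (Perm Om)) (hK : ∀ k ∈ K, sg * k * sg⁻¹ ∈ K)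
    (h11 : ¬ 11 ∣ Nat.card K) (k : Perm Om) (hk : k ∈ K) (hk0 : k none = none) : k = 1 := by
  have hKn : ∀ n : ℕ, ∀ k ∈ K, sg ^ n * k * (sg ^ n)⁻¹ ∈ K := by
    intro n
    induction n with
    | zero => intro k hk; simpa using hk
    | succ n ih =>
      intro k hk
      have := hK _ (ih k hk)
      rw [pow_succ']
      convert this using 1
      group
  -- fixing zero
  have key : ∀ k ∈ K, k none = none → k (some 0) = some 0 := by
    intro k hk hk0
    by_contra hne
    obtain ⟨a, ha⟩ : ∃ a, k (some 0) = some a := by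
      cases h : k (some 0) with
      | none => rw [← hk0] at h; simpa using k.injective h
      | some a => exact ⟨a, rfl⟩
    have ha0 : a ≠ 0 := by rintro rfl; exact hne ha
    have hm : ∀ m : ℕ, ∃ l ∈ K, l none = none ∧ l (some 0) = some (m * a) := by
      intro m
      induction m with
      | zero => exact ⟨1, K.one_mem, rfl, by simp⟩
      | succ m ih =>
        obtain ⟨l, hl, hl0, hl1⟩ := ih
        refine ⟨(sg ^ a.val * l * (sg ^ a.val)⁻¹) * k, K.mul_mem (hKn _ _ hl) hk, ?_, ?_⟩
        · have : (sg ^ a.val)⁻¹ none = none := by rw [Perm.inv_eq_iff_eq, sg_pow_none]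
          simp [Perm.mul_apply, hk0, this, hl0, sg_pow_none]
        · have : (sg ^ a.val)⁻¹ (some a) = some 0 := by
            rw [Perm.inv_eq_iff_eq, sg_pow_some]; simp
          rw [Perm.mul_apply, ha, Perm.mul_apply, Perm.mul_apply, this, hl1, sg_pow_some]
          simp; ring
    have : Fact (Nat.Prime 11) := ⟨by norm_num⟩
    have hall : ∀ x : ZMod 11, ∃ l ∈ K, l none = none ∧ l (some 0) = some x := by
      intro x
      obtain ⟨l, h1, h2, h3⟩ := hm (x * a⁻¹).val
      refine ⟨l, h1, h2, ?_⟩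
      rw [h3]; simp [ha0]
    -- stabilizer of none
    let S : Subgroup K := MulAction.stabilizer K (none : Om)
    have horb : MulAction.orbit S (some 0 : Om) = Set.range some := by
      ext y
      constructor
      · rintro ⟨⟨⟨l, hl⟩, hl0⟩, rfl⟩
        change l (some 0) ∈ _
        change l none = none at hl0
        cases h : l (some 0) with
        | none => rw [← hl0] at h; simpa using l.injective h
        | some a => exact ⟨a, rfl⟩
      · rintro ⟨x, rfl⟩
        obtain ⟨l, h1, h2, h3⟩ := hall x
        exact ⟨⟨⟨l, h1⟩, h2⟩, h3⟩
    have hc : (MulAction.orbit S (some 0 : Om)).ncard = 11 := by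
      rw [horb, ← Nat.card_coe_set_eq, Nat.card_range_of_injective (Option.some_injective _)]; simp
    have h1 : 11 ∣ Nat.card S := by
      rw [← hc, ← MulAction.index_stabilizer]; exact Subgroup.index_dvd_card _
    exact h11 (h1.trans (Subgroup.card_subgroup_dvd_card S))
  ext1 x
  cases x with
  | none => simpa using hk0
  | some x =>
    have h := key _ (hKn (11 - x.val) k hk) (by
      have : (sg ^ (11 - x.val))⁻¹ none = none := by rw [Perm.inv_eq_iff_eq, sg_pow_none]
      simp [Perm.mul_apply, this, hk0, sg_pow_none])
    have hx : (sg ^ (11 - x.val)) (some x) = some 0 := by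
      rw [sg_pow_some, Nat.cast_sub (ZMod.val_lt x).le]
      have : ((11 : ℕ) : ZMod 11) = 0 := CharP.cast_eq_zero (ZMod 11) 11
      rw [this]; simp
    have hx' : (sg ^ (11 - x.val))⁻¹ (some 0) = some x := by rw [Perm.inv_eq_iff_eq, hx]
    rw [Perm.mul_apply, Perm.mul_apply, hx'] at h
    have := (sg ^ (11 - x.val)).injective (h.trans hx.symm)
    simpa using this

theorem lemR_card (K : Subgroup (Perm Om)) (hK : ∀ k ∈ K, sg * k * sg⁻¹ ∈ K)
    (h11 : ¬ 11 ∣ Nat.card K) : Nat.card K ≤ 12 := by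
  have hinj : Function.Injective (fun k : K => k.1 none) := by
    intro k l h
    have := lemR K hK h11 (l⁻¹ * k : K).1 (l⁻¹ * k : K).2 (by
      change (l.1)⁻¹ (k.1 none) = none
      rw [Perm.inv_eq_iff_eq]; exact h)
    have h2 : l⁻¹ * k = 1 := Subtype.ext this
    exact (inv_mul_eq_one.1 h2).symm
  have := Nat.card_le_card_of_injective _ hinj
  simpa using this

theorem card_om : Fintype.card Om = 12 := by simp

theorem not_121 (H : Subgroup (Perm Om)) : ¬ 121 ∣ Nat.card H := by
  intro h
  have h2 := h.trans (Subgroup.card_subgroup_dvd_card H)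
  rw [Nat.card_eq_fintype_card, Fintype.card_perm, card_om] at h2
  revert h2; decide

/-- the Sylow subgroup generated by `sg` -/
noncomputable def syl (H : Subgroup (Perm Om)) (h : sg ∈ H) : Sylow 11 H :=
  haveI : Fact (Nat.Prime 11) := ⟨by norm_num⟩
  Sylow.ofCard (Subgroup.zpowers (⟨sg, h⟩ : H)) (by
    have h1 : orderOf (⟨sg, h⟩ : H) = 11 := by rw [Subgroup.orderOf_mk, sg_order]
    rw [Nat.card_zpowers, h1]
    have h2 : 11 ∣ Nat.card H := by rw [← h1]; exact orderOf_dvd_natCard _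
    have h3 : (Nat.card H).factorization 11 = 1 := by
      apply le_antisymm
      · by_contra hlt
        have := (Nat.Prime.pow_dvd_iff_le_factorization (p := 11) (k := 2) (by norm_num)
          (Nat.card_pos (α := H)).ne').2 (by omega)
        exact not_121 H (by simpa using this)
      · exact (Nat.Prime.dvd_iff_one_le_factorization (by norm_num)
          (Nat.card_pos (α := H)).ne').1 h2
    rw [h3, pow_one])

theorem syl_coe (H : Subgroup (Perm Om)) (h : sg ∈ H) :
    (syl H h : Subgroup H) = Subgroup.zpowers (⟨sg, h⟩ : H) := rfl

/-- Lemma T -/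
theorem lemT (H : Subgroup (Perm Om)) (h : sg ∈ H)
    (hN : Nat.card (Subgroup.normalizer (syl H h : Set H)) = 11) : Nat.card H ≤ 132 := by
  have : Fact (Nat.Prime 11) := ⟨by norm_num⟩
  have hc : Nat.card (syl H h) = 11 := by
    change Nat.card (syl H h : Subgroup H) = 11
    rw [syl_coe, Nat.card_zpowers, Subgroup.orderOf_mk, sg_order]
  have hle : (syl H h : Subgroup H) = Subgroup.normalizer (syl H h : Set H) := by
    apply Subgroup.eq_of_le_of_card_ge Subgroup.le_normalizer
    exact (hN.trans hc.symm).le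
  have hP : Subgroup.normalizer (syl H h : Set H) ≤ Subgroup.centralizer (syl H h : Set H) := by
    rw [← hle]
    have : IsMulCommutative (syl H h : Subgroup H) := by rw [syl_coe]; infer_instance
    exact Subgroup.le_centralizer _
  have hcomp := MonoidHom.ker_transferSylow_isComplement' (syl H h) hP
  set K := (MonoidHom.transferSylow (syl H h) hP).ker with hKdef
  have hmul : Nat.card K * 11 = Nat.card H := by
    rw [← hcomp.card_mul_card]; congr 1; exact hc.symm
  have hK11 : ¬ 11 ∣ Nat.card K := by
    intro hd
    apply not_121 H
    rw [← hmul]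
    exact Nat.mul_dvd_mul hd (dvd_refl 11)
  have hmap : Nat.card (K.map H.subtype) = Nat.card K :=
    Subgroup.card_map_of_injective H.subtype_injective
  have := lemR_card (K.map H.subtype) (by
    rintro k ⟨l, hl, rfl⟩
    refine ⟨⟨sg, h⟩ * l * ⟨sg, h⟩⁻¹, ?_, rfl⟩
    have hn : K.Normal := by rw [hKdef]; infer_instance
    exact hn.conj_mem l hl _) (by rwa [hmap])
  rw [hmap] at this
  omega
end M11

namespace M11
open Equiv

theorem q_dec1 : ∀ a b : ZMod 11, a ≠ 0 → qq none (some b) (some (a * 1 + b)) (some (a * 3 + b)) =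
    qq none (some 0) (some 1) (some 3) → a ^ 5 = 1 := by decide +kernel

theorem q_dec2 : (Finset.univ.filter fun p : Om × Om => qq none (some 0) p.1 p.2 = 1).card = 60 := by
  decide +kernel

theorem q_dec3 : qq none (some 0) (some 1) (some 2) = 1 := by decide +kernel

theorem q_dec4 : ∀ x ∈ ([3, 4, 5, 7, 8, 10] : List (ZMod 11)), ∀ y : Om,
    y ≠ none → y ≠ some 0 → y ≠ some 1 → y ≠ some 2 →
    qq none (some 0) (some 1) y = qq none (some 0) (some 1) (some x) →
    qq none (some 0) (some 2) y = qq none (some 0) (some 2) (some x) →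
    qq none (some 1) (some 2) y = qq none (some 1) (some 2) (some x) →
    qq (some 0) (some 1) (some 2) y = qq (some 0) (some 1) (some 2) (some x) → y = some x := by
  decide +kernel

theorem q_dec5 : ∃ a b c : Om, (∀ z ∈ [a, b, c], z ∈ ([none, some 0, some 1, some 2, some 3, some 4,
    some 5, some 7, some 8, some 10] : List Om)) ∧ qq a b c (some 6) ≠ qq a b c (some 9) := by
  decide +kernel

/-- invariance of `qq` -/
def QInv (H : Subgroup (Perm Om)) : Prop :=
  ∀ g ∈ H, ∀ a b c d, qq (g a) (g b) (g c) (g d) = qq a b c d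

theorem fix4 (H : Subgroup (Perm Om)) (hq : QInv H) (g : Perm Om) (hg : g ∈ H)
    (h0 : g none = none) (h1 : g (some 0) = some 0) (h2 : g (some 1) = some 1)
    (h3 : g (some 2) = some 2) : g = 1 := by
  have hx : ∀ x ∈ ([3, 4, 5, 7, 8, 10] : List (ZMod 11)), g (some x) = some x := by
    intro x hx
    have hx0 : x ≠ 0 ∧ x ≠ 1 ∧ x ≠ 2 := by
      revert x; decide
    apply q_dec4 x hx
    · intro h; rw [← h0] at h; simpa using g.injective h
    · intro h; rw [← h1] at h; exact hx0.1 (by simpa using g.injective h)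
    · intro h; rw [← h2] at h; exact hx0.2.1 (by simpa using g.injective h)
    · intro h; rw [← h3] at h; exact hx0.2.2 (by simpa using g.injective h)
    · have := hq g hg none (some 0) (some 1) (some x); rwa [h0, h1, h2] at this
    · have := hq g hg none (some 0) (some 2) (some x); rwa [h0, h1, h3] at this
    · have := hq g hg none (some 1) (some 2) (some x); rwa [h0, h2, h3] at this
    · have := hq g hg (some 0) (some 1) (some 2) (some x); rwa [h1, h2, h3] at this
  have hl : ∀ z ∈ ([none, some 0, some 1, some 2, some 3, some 4,
    some 5, some 7, some 8, some 10] : List Om), g z = z := by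
    intro z hz
    simp only [List.mem_cons, List.not_mem_nil, or_false] at hz
    rcases hz with rfl | rfl | rfl | rfl | rfl | rfl | rfl | rfl | rfl | rfl
    · exact h0
    · exact h1
    · exact h2
    · exact h3
    all_goals exact hx _ (by simp)
  have h6' : ∀ y : Om, y ∉ ([none, some 0, some 1, some 2, some 3, some 4,
      some 5, some 7, some 8, some 10] : List Om) → y = some 6 ∨ y = some 9 := by decide +kernel
  have hnl : ∀ y : Om, y ∉ ([none, some 0, some 1, some 2, some 3, some 4,
      some 5, some 7, some 8, some 10] : List Om) → g y ∉ ([none, some 0, some 1, some 2, some 3, some 4,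
      some 5, some 7, some 8, some 10] : List Om) := by
    intro y hy hgy
    have := g.injective (hl _ hgy)
    rw [this] at hgy; exact hy hgy
  have h6 : g (some 6) = some 6 := by
    rcases h6' _ (hnl (some 6) (by decide +kernel)) with h | h
    · exact h
    · exfalso
      obtain ⟨a, b, c, habc, hne⟩ := q_dec5
      have := hq g hg a b c (some 6)
      rw [hl a (habc a (by simp)), hl b (habc b (by simp)), hl c (habc c (by simp)), h] at this
      exact hne this.symm
  have h9 : g (some 9) = some 9 := by
    rcases h6' _ (hnl (some 9) (by decide +kernel)) with h | h
    · rw [← h6] at h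
      have := g.injective h
      exact absurd this (by decide)
    · exact h
  ext1 z
  by_cases hz : z ∈ ([none, some 0, some 1, some 2, some 3, some 4,
      some 5, some 7, some 8, some 10] : List Om)
  · exact hl z hz
  · rcases h6' z hz with rfl | rfl
    · exact h6
    · exact h9

theorem norm_aff (H : Subgroup (Perm Om)) (h : sg ∈ H) (g : H)
    (hg : g ∈ Subgroup.normalizer (syl H h : Set H)) :
    g.1 none = none ∧ ∃ a b : ZMod 11, ∀ x, g.1 (some x) = some (a * x + b) := by
  have h1 := (Subgroup.mem_normalizer_iff.1 hg ⟨sg, h⟩).1 (by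
    change _ ∈ (syl H h : Subgroup H)
    rw [syl_coe]; exact Subgroup.mem_zpowers _)
  rw [syl_coe, ← mem_powers_iff_mem_zpowers] at h1
  obtain ⟨n, hn⟩ := h1
  have hn' : sg ^ n = g.1 * sg * (g.1)⁻¹ := congrArg Subtype.val hn
  have hc : ∀ x, g.1 (sg x) = (sg ^ n) (g.1 x) := by
    intro x; rw [hn']; simp [Perm.mul_apply]
  have hn0 : (n : ZMod 11) ≠ 0 := by
    intro h0
    have : sg ^ n = 1 := by
      ext1 x
      cases x with
      | none => exact sg_pow_none n
      | some x => rw [sg_pow_some, h0]; simp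
    rw [this] at hn'
    have h3 : sg = 1 := by
      have := congrArg (fun t => (g.1)⁻¹ * t * g.1) hn'
      simpa [mul_assoc] using this.symm
    have := sg_order
    rw [h3] at this; simp at this
  have hnone : g.1 none = none := by
    have := hc none
    rw [sg_none] at this
    cases hh : g.1 none with
    | none => rfl
    | some y =>
      rw [hh, sg_pow_some] at this
      simp at this; exact absurd this hn0
  refine ⟨hnone, n, ?_⟩
  obtain ⟨b, hb⟩ : ∃ b, g.1 (some 0) = some b := by
    cases hh : g.1 (some 0) with
    | none => rw [← hnone] at hh; simpa using g.1.injective hh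
    | some a => exact ⟨a, rfl⟩
  refine ⟨b, ?_⟩
  have : ∀ m : ℕ, g.1 (some (m : ZMod 11)) = some (n * m + b) := by
    intro m
    induction m with
    | zero => simpa using hb
    | succ m ih =>
      have := hc (some m)
      rw [sg_some, ih, sg_pow_some] at this
      push_cast; rw [this]; congr 1; ring
  intro x
  have := this x.val
  rwa [ZMod.natCast_zmod_val] at this

noncomputable def affHom (H : Subgroup (Perm Om)) (h : sg ∈ H) :
    Subgroup.normalizer (syl H h : Set H) →* ZMod 11 where
  toFun g := (g.1.1 (some 1)).getD 0 - (g.1.1 (some 0)).getD 0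
  map_one' := by simp
  map_mul' g k := by
    obtain ⟨_, a, b, h1⟩ := norm_aff H h g.1 g.2
    obtain ⟨_, c, d, h2⟩ := norm_aff H h k.1 k.2
    simp [Perm.mul_apply, h1, h2]; ring

theorem ker5 : Nat.card (powMonoidHom 5 : (ZMod 11)ˣ →* (ZMod 11)ˣ).ker = 5 := by
  have h : Nat.card (powMonoidHom 5 : (ZMod 11)ˣ →* (ZMod 11)ˣ).ker =
      (Finset.univ.filter fun u : (ZMod 11)ˣ => u ^ 5 = 1).card := by
    rw [← Fintype.card_coe, ← Nat.card_eq_fintype_card]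
    exact Nat.card_congr (Equiv.subtypeEquivRight (by simp [MonoidHom.mem_ker]))
  rw [h]; decide +kernel

theorem norm_card (H : Subgroup (Perm Om)) (h : sg ∈ H) (hq : QInv H) :
    Nat.card (Subgroup.normalizer (syl H h : Set H)) = 11 ∨
    Nat.card (Subgroup.normalizer (syl H h : Set H)) = 55 := by
  have hpr : Fact (Nat.Prime 11) := ⟨by norm_num⟩
  set M := Subgroup.normalizer (syl H h : Set H) with hM
  let f : M →* (ZMod 11)ˣ := (affHom H h).toHomUnits
  have hf : ∀ g : M, ((f g : (ZMod 11)ˣ) : ZMod 11)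
    = (g.1.1 (some 1)).getD 0 - (g.1.1 (some 0)).getD 0 := fun g => rfl
  have h1 : Nat.card M = Nat.card f.ker * Nat.card f.range := by
    rw [← Subgroup.index_ker, Subgroup.card_mul_index]
  have h2 : Nat.card f.ker ≤ 11 := by
    have : Function.Injective (fun g : f.ker => (g.1.1.1 (some 0)).getD 0) := by
      intro g k hgk
      obtain ⟨g0, a, b, h1⟩ := norm_aff H h g.1.1 g.1.2
      obtain ⟨k0, c, d, h2⟩ := norm_aff H h k.1.1 k.1.2
      have hg := congrArg (fun u : (ZMod 11)ˣ => (u : ZMod 11)) (MonoidHom.mem_ker.1 g.2)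
      have hk := congrArg (fun u : (ZMod 11)ˣ => (u : ZMod 11)) (MonoidHom.mem_ker.1 k.2)
      simp only [hf, h1, h2] at hg hk hgk
      simp at hg hk hgk
      apply Subtype.ext; apply Subtype.ext; apply Subtype.ext
      ext1 x
      cases x with
      | none => rw [g0, k0]
      | some x => rw [h1, h2, hg, hk, hgk]
    have := Nat.card_le_card_of_injective _ this
    simpa using this
  have h3 : Nat.card f.range ∣ 5 := by
    have hle : f.range ≤ (powMonoidHom 5 : (ZMod 11)ˣ →* (ZMod 11)ˣ).ker := by
      rintro _ ⟨g, rfl⟩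
      rw [MonoidHom.mem_ker, powMonoidHom_apply]
      ext
      push_cast
      obtain ⟨g0, a, b, h1⟩ := norm_aff H h g.1 g.2
      have hfa : ((f g : (ZMod 11)ˣ) : ZMod 11) = a := by rw [hf, h1, h1]; simp
      have ha0 : a ≠ 0 := by rw [← hfa]; exact (f g).ne_zero
      rw [hfa]
      apply q_dec1 a b ha0
      have := hq g.1.1 g.1.2 none (some 0) (some 1) (some 3)
      rw [g0, h1, h1, h1] at this
      simpa using this
    rw [← ker5]
    exact Subgroup.card_dvd_of_le hle
  have h4 : 11 ∣ Nat.card M := by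
    have : (⟨sg, h⟩ : H) ∈ M := by
      apply Subgroup.le_normalizer (H := (syl H h : Subgroup H))
      rw [syl_coe]; exact Subgroup.mem_zpowers _
    have h5 : orderOf (⟨⟨sg, h⟩, this⟩ : M) = 11 := by
      rw [Subgroup.orderOf_mk, Subgroup.orderOf_mk, sg_order]
    rw [← h5]; exact orderOf_dvd_natCard _
  have hpos : 0 < Nat.card f.ker := Nat.card_pos
  rcases (Nat.dvd_prime (by norm_num)).1 h3 with h5 | h5
  · left; rw [h5] at h1; omega
  · right; rw [h5] at h1; omega

/-- two point transitivity gives the order -/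
theorem two_trans (H : Subgroup (Perm Om)) (h : sg ∈ H) (hq : QInv H)
    (ht : ∀ x, ∃ g ∈ H, g none = x) : ∃ k, Nat.card H = 132 * k ∧ k ≤ 60 := by
  let T := MulAction.stabilizer H ((none, some 0) : Om × Om)
  have hT : ∀ g : T, g.1.1 none = none ∧ g.1.1 (some 0) = some 0 := by
    intro g
    have := g.2
    rw [MulAction.mem_stabilizer_iff, Prod.smul_mk, Prod.mk.injEq] at this
    exact this
  refine ⟨Nat.card T, ?_, ?_⟩
  · have horb : MulAction.orbit H ((none, some 0) : Om × Om) =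
        ((Finset.univ.filter fun p : Om × Om => p.1 ≠ p.2 : Finset _) : Set (Om × Om)) := by
      ext ⟨x, y⟩
      simp only [Finset.coe_filter, Finset.mem_univ, true_and, Set.mem_ofPred_eq]
      constructor
      · rintro ⟨g, hg⟩
        obtain ⟨h1, h2⟩ := Prod.mk.inj hg
        rw [← h1, ← h2]
        intro h3
        have := g.1.injective h3
        simp at this
      · intro hxy
        obtain ⟨g, hg, hgx⟩ := ht x
        obtain ⟨a, ha⟩ : ∃ a, g⁻¹ y = some a := by
          cases hh : g⁻¹ y with
          | none =>
            rw [Perm.inv_eq_iff_eq, hgx] at hh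
            exact absurd hh.symm hxy
          | some a => exact ⟨a, rfl⟩
        refine ⟨⟨g * sg ^ a.val, H.mul_mem hg (H.pow_mem h _)⟩, ?_⟩
        change ((g * sg ^ a.val) none, (g * sg ^ a.val) (some 0)) = (x, y)
        rw [Perm.mul_apply, Perm.mul_apply, sg_pow_none, sg_pow_some, hgx]
        simp only [zero_add, ZMod.natCast_zmod_val, ← ha]
        simp
    rw [← Subgroup.index_mul_card T, MulAction.index_stabilizer, horb, Set.ncard_coe_finset]
    congr 1
  · have hinj : Function.Injective (fun g : T => (⟨(g.1.1 (some 1), g.1.1 (some 2)), by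
        rw [Finset.mem_filter]
        refine ⟨Finset.mem_univ _, ?_⟩
        have := hq g.1.1 g.1.2 none (some 0) (some 1) (some 2)
        rwa [(hT g).1, (hT g).2, q_dec3] at this⟩ :
        (Finset.univ.filter fun p : Om × Om => qq none (some 0) p.1 p.2 = 1))) := by
      intro g k hgk
      simp only [Subtype.mk.injEq, Prod.mk.injEq] at hgk
      have := fix4 H hq (k⁻¹ * g : T).1.1 (k⁻¹ * g : T).1.2 (hT _).1 (hT _).2
        (by change (k.1.1)⁻¹ (g.1.1 (some 1)) = _; rw [Perm.inv_eq_iff_eq]; exact hgk.1)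
        (by change (k.1.1)⁻¹ (g.1.1 (some 2)) = _; rw [Perm.inv_eq_iff_eq]; exact hgk.2)
      have h2 : k⁻¹ * g = 1 := Subtype.ext (Subtype.ext this)
      exact (inv_mul_eq_one.1 h2).symm
    have := Nat.card_le_card_of_injective _ hinj
    rwa [Nat.card_eq_fintype_card (α := Finset.filter _ _), Fintype.card_coe, q_dec2] at this

theorem order_eq (H : Subgroup (Perm Om)) (h : sg ∈ H) (hq : QInv H)
    (ht : ∀ x, ∃ g ∈ H, g none = x) (h8 : 8 ∣ Nat.card H) : Nat.card H = 7920 ∧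
    Nat.card (Subgroup.normalizer (syl H h : Set H)) = 55 := by
  have hpr : Fact (Nat.Prime 11) := ⟨by norm_num⟩
  obtain ⟨k, hk, hk60⟩ := two_trans H h hq ht
  have hpos : 0 < Nat.card H := Nat.card_pos
  have h55 : Nat.card (Subgroup.normalizer (syl H h : Set H)) = 55 := by
    rcases norm_card H h hq with h1 | h1
    · have := lemT H h h1
      have : k = 1 ∨ k = 0 := by omega
      rcases this with rfl | rfl <;> omega
    · exact h1
  have hi := Subgroup.card_mul_index (Subgroup.normalizer (syl H h : Set H))
  have hs := Sylow.card_eq_index_normalizer (syl H h)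
  have hm := card_sylow_modEq_one 11 H
  rw [hs] at hm
  change _ % 11 = 1 % 11 at hm
  refine ⟨?_, h55⟩
  generalize (Subgroup.normalizer (syl H h : Set H)).index = n at *
  rw [h55] at hi
  omega
end M11

namespace M11
open Equiv

theorem conj11 (H : Subgroup (Perm Om)) (h : sg ∈ H) (N : Subgroup H) [hN : N.Normal]
    (h11 : ¬ 11 ∣ Nat.card N) (P : H → Prop)
    (hP : ∀ k, P k → P (⟨sg, h⟩ * k * ⟨sg, h⟩⁻¹)) (hP1 : ¬ P 1) :
    11 ∣ Nat.card {k : H // k ∈ N ∧ P k} := by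
  classical
  have hpr : Fact (Nat.Prime 11) := ⟨by norm_num⟩
  let s : H := ⟨sg, h⟩
  let f : Function.End {k : H // k ∈ N ∧ P k} := fun k =>
    ⟨s * k.1 * s⁻¹, hN.conj_mem _ k.2.1 s, hP _ k.2.2⟩
  have hf : ∀ n : ℕ, ∀ k, ((f ^ n) k).1 = s ^ n * k.1 * (s ^ n)⁻¹ := by
    intro n
    induction n with
    | zero => intro k; simp; rfl
    | succ n ih =>
      intro k
      rw [pow_succ']
      change s * ((f ^ n) k).1 * s⁻¹ = _
      rw [ih, pow_succ']; group
  have hs : s ^ 11 = 1 := by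
    have : orderOf s = 11 := by rw [Subgroup.orderOf_mk, sg_order]
    rw [← this]; exact pow_orderOf_eq_one s
  have hf11 : f ^ 11 ^ 1 = 1 := by
    funext k
    apply Subtype.ext
    rw [hf]; simp [hs]; rfl
  have := Equiv.Perm.card_fixedPoints_modEq hf11
  have hempty : IsEmpty f.fixedPoints := by
    constructor
    rintro ⟨k, hk⟩
    have hk' : s * k.1 * s⁻¹ = k.1 := congrArg Subtype.val hk
    have hc : sg * k.1.1 = k.1.1 * sg := congrArg Subtype.val (mul_inv_eq_iff_eq_mul.1 hk')
    have h0 : k.1.1 none = none := by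
      apply sg_fix
      have := congrArg (fun t : Perm Om => t none) hc
      simpa using this
    have h1 := lemR (N.map H.subtype) (by
      rintro k ⟨l, hl, rfl⟩
      exact ⟨s * l * s⁻¹, hN.conj_mem l hl _, rfl⟩) (by
      rwa [Subgroup.card_map_of_injective H.subtype_injective]) k.1.1 ⟨k.1, k.2.1, rfl⟩ h0
    have h2 : k.1 = 1 := Subtype.ext h1
    apply hP1; rw [← h2]; exact k.2.2
  have h0 : ∀ i : Fintype (Function.fixedPoints f), @Fintype.card _ i = 0 :=
    fun i => @Fintype.card_eq_zero _ i hempty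
  rw [h0] at this
  rw [Nat.card_eq_fintype_card]
  exact (Nat.modEq_zero_iff_dvd).1 this

theorem simple_of (H : Subgroup (Perm Om)) (h : sg ∈ H) (hq : QInv H)
    (hc : Nat.card H = 7920)
    (h55 : Nat.card (Subgroup.normalizer (syl H h : Set H)) = 55) : IsSimpleGroup H := by
  have hpr : Fact (Nat.Prime 11) := ⟨by norm_num⟩
  have hnt : Nontrivial H := by
    rw [← Finite.one_lt_card_iff_nontrivial, hc]; norm_num
  refine ⟨fun N hN => ?_⟩
  have hmap : Nat.card (N.map H.subtype) = Nat.card N :=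
    Subgroup.card_map_of_injective H.subtype_injective
  have hci := Subgroup.card_mul_index N
  by_cases h11 : 11 ∣ Nat.card N
  · right
    -- sg lies in N
    have hsN : (⟨sg, h⟩ : H) ∈ N := by
      rw [← QuotientGroup.eq_one_iff, ← orderOf_eq_one_iff]
      have h1 : orderOf ((⟨sg, h⟩ : H) : H ⧸ N) ∣ 11 := by
        have := orderOf_map_dvd (QuotientGroup.mk' N) (⟨sg, h⟩ : H)
        rwa [Subgroup.orderOf_mk, sg_order] at this
      have h2 : orderOf ((⟨sg, h⟩ : H) : H ⧸ N) ∣ N.index := orderOf_dvd_natCard _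
      rcases (Nat.dvd_prime (by norm_num)).1 h1 with h3 | h3
      · exact h3
      · rw [h3] at h2
        exfalso
        apply not_121 H
        rw [← hci]
        exact Nat.mul_dvd_mul h11 h2
    have hle : (syl H h : Subgroup H) ≤ N := by
      rw [syl_coe, Subgroup.zpowers_le]; exact hsN
    have htop := Sylow.normalizer_sup_eq_top' (syl H h) hle
    have hsN' : sg ∈ N.map H.subtype := ⟨_, hsN, rfl⟩
    have hqN : QInv (N.map H.subtype) := by
      rintro _ ⟨g, _, rfl⟩; exact hq g.1 g.2
    rcases norm_card _ hsN' hqN with h1 | h1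
    · have h2 := lemT _ hsN' h1
      rw [hmap] at h2
      have h3 : N.index ≤ 55 := by
        rw [← h55]
        have h4 : (Subgroup.normalizer (syl H h : Set H)).map (QuotientGroup.mk' N) = ⊤ := by
          have := congrArg (Subgroup.map (QuotientGroup.mk' N)) htop
          rw [Subgroup.map_sup, Subgroup.map_top_of_surjective _ (QuotientGroup.mk'_surjective N)]
            at this
          have h5 : N.map (QuotientGroup.mk' N) = ⊥ := by
            rw [Subgroup.map_eq_bot_iff, QuotientGroup.ker_mk']
          rwa [h5, sup_bot_eq] at this
        have h6 : N.index = Nat.card ((Subgroup.normalizer (syl H h : Set H)).map (QuotientGroup.mk' N)) := by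
          rw [h4, Subgroup.card_top]; rfl
        rw [h6]
        exact Nat.card_le_card_of_surjective _ (MonoidHom.subgroupMap_surjective (QuotientGroup.mk' N) _)
      have : Nat.card N * N.index ≤ 132 * 55 := Nat.mul_le_mul h2 h3
      rw [hci, hc] at this
      omega
    · have hMN : Subgroup.normalizer (syl H h : Set H) ≤ N := by
        have hinj : Nat.card (Subgroup.normalizer (syl (N.map H.subtype) hsN' : Set (N.map H.subtype)))
            ≤ Nat.card (N ⊓ Subgroup.normalizer (syl H h : Set H) : Subgroup H) := by
          have hmem : ∀ g : N.map H.subtype, g ∈ Subgroup.normalizer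
              (syl (N.map H.subtype) hsN' : Set (N.map H.subtype)) →
              ∃ k : H, k ∈ N ⊓ Subgroup.normalizer (syl H h : Set H) ∧ k.1 = g.1 := by
            rintro ⟨_, ⟨k, hkN, rfl⟩⟩ hg
            refine ⟨k, ⟨hkN, ?_⟩, rfl⟩
            have h1 := (Subgroup.mem_normalizer_iff.1 hg ⟨sg, hsN'⟩).1 (by
              change _ ∈ (syl (N.map H.subtype) hsN' : Subgroup (N.map H.subtype))
              rw [syl_coe]; exact Subgroup.mem_zpowers _)
            rw [syl_coe] at h1
            obtain ⟨n, hn⟩ := h1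
            have hn' : sg ^ n = k.1 * sg * (k.1)⁻¹ := congrArg Subtype.val hn
            apply Subgroup.mem_normalizer_fintype
            intro x hx
            change _ ∈ (syl H h : Subgroup H) at hx ⊢
            rw [syl_coe] at hx ⊢
            obtain ⟨m, rfl⟩ := hx
            refine ⟨n * m, ?_⟩
            apply Subtype.ext
            change sg ^ (n * m) = k.1 * sg ^ m * (k.1)⁻¹
            rw [zpow_mul, hn', conj_zpow]
          choose! φ h1 h2 using hmem
          refine Nat.card_le_card_of_injective (fun g => ⟨φ g.1, h1 g.1 g.2⟩) ?_
          intro g k hgk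
          have h3 : φ g.1 = φ k.1 := congrArg Subtype.val hgk
          apply Subtype.ext; apply Subtype.ext
          rw [← h2 g.1 g.2, ← h2 k.1 k.2, h3]
        rw [h1] at hinj
        have : N ⊓ Subgroup.normalizer (syl H h : Set H) = Subgroup.normalizer (syl H h : Set H) :=
          Subgroup.eq_of_le_of_card_ge inf_le_right (by rw [h55]; exact hinj)
        rw [← this]; exact inf_le_left
      rwa [sup_eq_right.2 hMN] at htop
  · left
    have hle := lemR_card (N.map H.subtype) (by
      rintro k ⟨l, hl, rfl⟩
      exact ⟨⟨sg, h⟩ * l * ⟨sg, h⟩⁻¹, hN.conj_mem l hl _, rfl⟩) (by rwa [hmap])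
    rw [hmap] at hle
    by_contra hne
    have hcardP : ∀ l : ℕ, l.Prime → l ∣ Nat.card N →
        11 ≤ Nat.card {k : H // k ∈ N ∧ orderOf k = l} := by
      intro l hl hd
      have : Fact l.Prime := ⟨hl⟩
      obtain ⟨x, hx⟩ := exists_prime_orderOf_dvd_card' l hd
      have hne : Nonempty {k : H // k ∈ N ∧ orderOf k = l} :=
        ⟨⟨x.1, x.2, by rw [← hx]; exact Subgroup.orderOf_coe x⟩⟩
      refine Nat.le_of_dvd Nat.card_pos (conj11 H h N h11 (fun k => orderOf k = l) ?_ ?_)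
      · intro k hk
        rw [← hk]
        exact (MulAut.conj (⟨sg, h⟩ : H)).orderOf_eq k
      · simpa using hl.one_lt.ne
    have h1 : 11 ∣ Nat.card {k : H // k ∈ N ∧ k ≠ 1} := by
      apply conj11 H h N h11
      · intro k hk h2; apply hk
        simpa using h2
      · simp
    have h2 : Nat.card {k : H // k ∈ N ∧ k ≠ 1} + 1 = Nat.card N := by
      have e : {k : H // k ∈ N ∧ k ≠ 1} ≃ {k : N // k ≠ 1} :=
        { toFun := fun k => ⟨⟨k.1, k.2.1⟩, fun h => k.2.2 (congrArg Subtype.val h)⟩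
          invFun := fun k => ⟨k.1.1, k.1.2, fun h => k.2 (Subtype.ext h)⟩
          left_inv := fun _ => rfl
          right_inv := fun _ => rfl }
      rw [Nat.card_congr e]
      classical
      rw [Nat.card_eq_fintype_card, Nat.card_eq_fintype_card, Fintype.card_subtype_compl]
      simp
      exact Nat.sub_add_cancel Fintype.card_pos
    have h3 : Nat.card N ≠ 1 := fun h => hne (Subgroup.card_eq_one.1 h)
    have h12 : Nat.card N = 12 := by omega
    have ha := hcardP 2 (by norm_num) (by rw [h12]; norm_num)
    have hb := hcardP 3 (by norm_num) (by rw [h12]; norm_num)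
    have hab : Nat.card ({k : H // k ∈ N ∧ orderOf k = 2} ⊕ {k : H // k ∈ N ∧ orderOf k = 3}) ≤
        Nat.card N := by
      refine Nat.card_le_card_of_injective
        (Sum.elim (fun k => (⟨k.1, k.2.1⟩ : N)) (fun k => ⟨k.1, k.2.1⟩)) ?_
      rintro (⟨k, hk⟩ | ⟨k, hk⟩) (⟨l, hl⟩ | ⟨l, hl⟩) hkl <;>
        simp only [Sum.elim_inl, Sum.elim_inr, Subtype.mk.injEq] at hkl <;> subst hkl
      · rfl
      · omega
      · omega
      · rfl
    rw [Nat.card_sum] at hab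
    omega
end M11

namespace M11
open Equiv

structure Hyp {Ω : Type*} [Fintype Ω] [DecidableEq Ω] (H : Subgroup (Perm Ω)) (B : Finset (Ω → Bool)) : Prop where
  card : Fintype.card Ω = 12
  tr : ∀ x y : Ω, ∃ g ∈ H, g x = y
  h8 : 8 ∣ Nat.card H
  ne : B.Nonempty
  le : B.card ≤ 22
  six : ∀ b ∈ B, (Finset.univ.filter fun x => b x = true).card = 6
  compl : ∀ b ∈ B, (fun x => !b x) ∈ B
  inv : ∀ g ∈ H, ∀ b ∈ B, (fun x => b (g x)) ∈ B

def Concl (G : Type*) [Group G] : Prop := Nat.card G = 7920 ∧ IsSimpleGroup G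

theorem Concl.congr {G G' : Type*} [Group G] [Group G'] (e : G ≃* G') (h : Concl G) : Concl G' := by
  obtain ⟨h1, h2⟩ := h
  refine ⟨by rw [← Nat.card_congr e.toEquiv, h1], ?_⟩
  have : Nontrivial G' := e.symm.toEquiv.nontrivial
  exact IsSimpleGroup.isSimpleGroup_of_surjective e.toMonoidHom e.surjective

theorem Hyp.map {Ω Ω' : Type*} [Fintype Ω] [Fintype Ω'] [DecidableEq Ω] [DecidableEq Ω']
    {H : Subgroup (Perm Ω)} {B : Finset (Ω → Bool)}
    (h : Hyp H B) (e : Ω ≃ Ω') :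
    Hyp (H.map (Equiv.permCongrHom e).toMonoidHom)
      (B.map ⟨fun b x => b (e.symm x), fun b c hbc => by
        funext x; simpa using congrFun hbc (e x)⟩) where
  card := by rw [← Fintype.card_congr e, h.card]
  tr x y := by
    obtain ⟨g, hg, hxy⟩ := h.tr (e.symm x) (e.symm y)
    refine ⟨_, ⟨g, hg, rfl⟩, ?_⟩
    simp [Equiv.permCongrHom, Equiv.permCongr_apply, hxy]
  h8 := by
    rw [Subgroup.card_map_of_injective (Equiv.permCongrHom e).injective]
    exact h.h8
  ne := by simpa using h.ne
  le := by rw [Finset.card_map]; exact h.le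
  six := by
    intro b hb
    rw [Finset.mem_map] at hb
    obtain ⟨c, hc, rfl⟩ := hb
    rw [← h.six c hc]
    apply Finset.card_bij (fun x _ => e.symm x)
    · intro x hx
      rw [Finset.mem_filter] at hx ⊢
      exact ⟨Finset.mem_univ _, hx.2⟩
    · intro x _ y _ h; simpa using h
    · intro x hx
      rw [Finset.mem_filter] at hx
      refine ⟨e x, ?_, by simp⟩
      rw [Finset.mem_filter]
      refine ⟨Finset.mem_univ _, ?_⟩
      change c (e.symm (e x)) = true
      rw [Equiv.symm_apply_apply]; exact hx.2
  compl := by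
    intro b hb
    rw [Finset.mem_map] at hb ⊢
    obtain ⟨c, hc, rfl⟩ := hb
    exact ⟨_, h.compl c hc, rfl⟩
  inv := by
    rintro _ ⟨g, hg, rfl⟩ b hb
    rw [Finset.mem_map] at hb ⊢
    obtain ⟨c, hc, rfl⟩ := hb
    refine ⟨_, h.inv g hg c hc, ?_⟩
    funext x
    change c (g (e.symm x)) = c (e.symm (e (g (e.symm x))))
    rw [Equiv.symm_apply_apply]

/-- shift -/
def sh (i : ZMod 11) (x : Om) : Om := x.map (· + i)

theorem sh_eq (i : ZMod 11) (x : Om) : sh i x = (sg ^ i.val) x := by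
  cases x with
  | none => rw [sg_pow_none]; rfl
  | some x => rw [sg_pow_some]; simp [sh]

def phi (b : Om → Bool) (p : Bool × ZMod 11) : Om → Bool := fun x => xor p.1 (b (sh p.2 x))

theorem shift_const (A : ZMod 11 → Bool) (d : ZMod 11) (hd : d ≠ 0) (h : ∀ x, A (x + d) = A x) :
    ∀ x, A x = A 0 := by
  have : Fact (Nat.Prime 11) := ⟨by norm_num⟩
  have hm : ∀ m : ℕ, A (m * d) = A 0 := by
    intro m
    induction m with
    | zero => simp
    | succ m ih => rw [← ih, ← h (m * d)]; congr 1; push_cast; ring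
  intro x
  have := hm (x * d⁻¹).val
  rw [← this]; simp [hd]

theorem phi_inj (b : Om → Bool) (hb : (Finset.univ.filter fun x => b x = true).card = 6) :
    Function.Injective (phi b) := by
  rintro ⟨s, i⟩ ⟨t, j⟩ h
  have h0 : xor s (b none) = xor t (b none) := congrFun h none
  have hst : s = t := by revert h0; cases s <;> cases t <;> cases b none <;> simp
  subst hst
  have h1 : ∀ x : ZMod 11, b (some (x + i)) = b (some (x + j)) := by
    intro x
    have : xor s (b (some (x + i))) = xor s (b (some (x + j))) := congrFun h (some x)
    simpa using this
  by_contra hne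
  have hij : j - i ≠ 0 := by
    intro h; apply hne; rw [sub_eq_zero.1 h]
  have h2 := shift_const (fun x => b (some x)) (j - i) hij (fun x => by
    have := h1 (x - i); rw [sub_add_cancel] at this; rw [this]; congr 2; ring)
  have h3 : ∀ x : Om, b x = if x = none then b none else b (some 0) := by
    intro x; cases x with
    | none => rfl
    | some x => simpa using h2 x
  have h4 : ∀ u v : Bool, (Finset.univ.filter fun x : Om =>
    (if x = none then u else v) = true).card ≠ 6 := by decide +kernel
  apply h4 (b none) (b (some 0))
  rw [← hb]; congr 1; ext x; simp only [Finset.mem_filter, h3 x]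

theorem B_eq {H : Subgroup (Perm Om)} {B : Finset (Om → Bool)} (h : Hyp H B) (hs : sg ∈ H)
    (b : Om → Bool) (hb : b ∈ B) : B = Finset.univ.map ⟨phi b, phi_inj b (h.six b hb)⟩ := by
  symm
  apply Finset.eq_of_subset_of_card_le
  · intro c hc
    rw [Finset.mem_map] at hc
    obtain ⟨⟨s, i⟩, -, rfl⟩ := hc
    have h1 : (fun x => b (sh i x)) ∈ B := by
      simp only [sh_eq]
      exact h.inv _ (H.pow_mem hs _) b hb
    cases s with
    | false =>
      change (fun x => xor false (b (sh i x))) ∈ B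
      simpa using h1
    | true =>
      change (fun x => xor true (b (sh i x))) ∈ B
      simpa using h.compl _ h1
  · refine h.le.trans ?_
    rw [Finset.card_map]; simp

theorem lam_inv {H : Subgroup (Perm Om)} {B : Finset (Om → Bool)} (h : Hyp H B) (g : Perm Om)
    (hg : g ∈ H) (x y : Om) :
    (B.filter fun b => b (g x) = b (g y)).card = (B.filter fun b => b x = b y).card := by
  apply Finset.card_nbij' (fun b z => b (g z)) (fun b z => b (g⁻¹ z))
  · intro b hb; simp only [Finset.coe_filter, Set.mem_ofPred_eq] at hb ⊢
    exact ⟨h.inv g hg b hb.1, hb.2⟩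
  · intro b hb; simp only [Finset.coe_filter, Set.mem_ofPred_eq] at hb ⊢
    exact ⟨h.inv _ (H.inv_mem hg) b hb.1, by simpa using hb.2⟩
  · intro b _; funext z; simp
  · intro b _; funext z; simp

theorem lam_eq {H : Subgroup (Perm Om)} {B : Finset (Om → Bool)} (h : Hyp H B) (hs : sg ∈ H)
    (b : Om → Bool) (hb : b ∈ B) (x y : Om) : (B.filter fun b => b x = b y).card =
    2 * (Finset.univ.filter fun i => b (sh i x) = b (sh i y)).card := by
  conv_lhs => rw [B_eq h hs b hb]
  rw [Finset.filter_map, Finset.card_map]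
  have : (Finset.univ.filter ((fun b : Om → Bool => b x = b y) ∘ (⟨phi b, phi_inj b (h.six b hb)⟩ :
      Bool × ZMod 11 ↪ (Om → Bool)))) = Finset.univ ×ˢ
      (Finset.univ.filter fun i => b (sh i x) = b (sh i y)) := by
    ext ⟨s, i⟩
    simp [phi]
  rw [this, Finset.card_product]; simp

def pdsB (n : ℕ) : Bool :=
  decide ((Finset.univ.filter fun i : ZMod 11 => n.testBit i.val = true).card = 5) &&
  decide (∀ d : ZMod 11, d ≠ 0 →
    (Finset.univ.filter fun i : ZMod 11 => n.testBit i.val = n.testBit (i + d).val).card = 5)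

theorem pds : ∀ n < 2048, pdsB n = true →
    (∃ k : ZMod 11, ∀ i : ZMod 11, n.testBit i.val = blk k (some i)) ∨
    (∃ k : ZMod 11, ∀ i : ZMod 11, n.testBit i.val = blk k (some (-i))) := by
  decide +kernel

/-- sign change -/
def nu : Perm Om := Equiv.optionCongr (Equiv.neg (ZMod 11))

theorem cls {H : Subgroup (Perm Om)} {B : Finset (Om → Bool)} (h : Hyp H B) (hs : sg ∈ H) :
    ∃ k, blk k ∈ B ∨ (fun x => blk k (nu x)) ∈ B := by
  obtain ⟨b, hb, hbn⟩ : ∃ b ∈ B, b none = true := by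
    obtain ⟨b, hb⟩ := h.ne
    cases hbn : b none with
    | true => exact ⟨b, hb, hbn⟩
    | false => exact ⟨_, h.compl b hb, by simp [hbn]⟩
  let f : Fin 11 → Bool := fun i => b (some i)
  have hlt := Nat.ofBits_lt_two_pow f
  have htb : ∀ i : ZMod 11, (Nat.ofBits f).testBit i.val = b (some i) := fun i =>
    Nat.testBit_ofBits_lt f i.val i.isLt
  have h6 := h.six b hb
  have hfive : (Finset.univ.filter fun i : ZMod 11 => b (some i) = true).card = 5 := by
    have : (Finset.univ.filter fun x => b x = true) =
        insert none ((Finset.univ.filter fun i : ZMod 11 => b (some i) = true).map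
          Function.Embedding.some) := by
      ext x; cases x <;> simp [hbn]
    rw [this, Finset.card_insert_of_notMem (by simp), Finset.card_map] at h6
    omega
  have h2 := pds (Nat.ofBits f) hlt ?_
  · rcases h2 with ⟨k, hk⟩ | ⟨k, hk⟩
    · refine ⟨k, Or.inl ?_⟩
      convert hb using 1
      funext x; cases x with
      | none => rw [hbn]; rfl
      | some x => rw [← htb, hk]
    · refine ⟨k, Or.inr ?_⟩
      convert hb using 1
      funext x; cases x with
      | none => rw [hbn]; rfl
      | some x => rw [← htb, hk]; rfl
  rw [pdsB, Bool.and_eq_true, decide_eq_true_iff, decide_eq_true_iff]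
  constructor
  · rw [← hfive]; congr 1; ext i; rw [Finset.mem_filter, Finset.mem_filter, htb]
  · intro d hd
    have e1 := lam_eq h hs b hb none (some 0)
    have e2 := lam_eq h hs b hb (some 0) (some d)
    have e3 : (B.filter fun b => b none = b (some 0)).card =
        (B.filter fun b => b (some 0) = b (some d)).card := by
      obtain ⟨g, hg, hg0⟩ := h.tr none (some 0)
      have hgi : ∃ y, g (some y) = some d := by
        cases hy : g.symm (some d) with
        | none =>
          rw [Equiv.symm_apply_eq, hg0] at hy
          exact absurd (Option.some.inj hy) hd
        | some y => exact ⟨y, by rw [← hy]; simp⟩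
      obtain ⟨y, hy⟩ := hgi
      have h1 := lam_inv h g hg none (some y)
      have h2 := lam_inv h (sg ^ y.val) (H.pow_mem hs _) none (some 0)
      rw [sg_pow_none, sg_pow_some] at h2
      rw [hg0, hy] at h1
      rw [h1, ← h2, zero_add, ZMod.natCast_zmod_val]
    have e4 : (Finset.univ.filter fun i => b (sh i none) = b (sh i (some 0))).card = 5 := by
      rw [← hfive]; congr 1; ext i
      rw [Finset.mem_filter, Finset.mem_filter]
      simp only [sh, Option.map_some, Option.map_none, zero_add, hbn, @eq_comm _ true]
    have e5 : (Finset.univ.filter fun i : ZMod 11 => (Nat.ofBits f).testBit i.val =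
        (Nat.ofBits f).testBit (i + d).val).card =
        (Finset.univ.filter fun i => b (sh i (some 0)) = b (sh i (some d))).card := by
      congr 1; ext i
      rw [Finset.mem_filter, Finset.mem_filter, htb, htb, add_comm i d]
      simp only [sh, Option.map_some, zero_add]
    omega

theorem blk_inj : ∀ k l : ZMod 11, (∀ x, blk k x = blk l x) → k = l := by decide +kernel

theorem blk_sh : ∀ k i : ZMod 11, ∀ x, blk k (sh i x) = blk (k - i) x := by decide +kernel

theorem concl_of_blk {H : Subgroup (Perm Om)} {B : Finset (Om → Bool)} (h : Hyp H B) (hs : sg ∈ H)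
    (k : ZMod 11) (hk : blk k ∈ B) : Concl H := by
  have hq : QInv H := by
    intro g hg a b c d
    have hB := B_eq h hs _ hk
    have h0 : ∀ l : ZMod 11, blk l ∈ B := by
      intro l
      rw [hB, Finset.mem_map]
      refine ⟨(false, k - l), Finset.mem_univ _, ?_⟩
      funext x; simp [phi, blk_sh]
    have h1 : ∀ l : ZMod 11, ∃ (s : Bool) (m : ZMod 11), ∀ x, blk l (g x) = xor s (blk m x) := by
      intro l
      have := h.inv g hg _ (h0 l)
      rw [hB, Finset.mem_map] at this
      obtain ⟨⟨s, i⟩, -, hi⟩ := this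
      refine ⟨s, k - i, fun x => ?_⟩
      rw [← blk_sh]; exact (congrFun hi x).symm
    choose s π hπ using h1
    have hinj : Function.Injective π := by
      intro l m hlm
      have h2 : ∀ x, blk l x = xor (xor (s l) (s m)) (blk m x) := by
        intro x
        have h3 := hπ l (g⁻¹ x)
        have h4 := hπ m (g⁻¹ x)
        rw [show g (g⁻¹ x) = x from g.apply_symm_apply x] at h3 h4
        rw [h3, h4, hlm]
        cases s l <;> cases s m <;> simp
      have h5 := h2 none
      apply blk_inj
      intro x
      rw [h2 x]
      have : xor (s l) (s m) = false := by
        change true = xor _ true at h5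
        revert h5; cases xor (s l) (s m) <;> simp
      rw [this]; simp
    unfold qq
    apply Finset.card_bij (fun l _ => π l)
    · intro l hl
      simp only [Finset.mem_filter, hπ] at hl ⊢
      refine ⟨Finset.mem_univ _, ?_⟩
      have := hl.2
      cases s l <;> simpa using this
    · intro l _ m _ hlm; exact hinj hlm
    · intro m hm
      obtain ⟨l, rfl⟩ := (Finite.injective_iff_surjective.1 hinj) m
      refine ⟨l, ?_, rfl⟩
      simp only [Finset.mem_filter, hπ] at hm ⊢
      refine ⟨Finset.mem_univ _, ?_⟩
      have := hm.2
      cases s l <;> simpa using this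
  obtain ⟨h1, h2⟩ := order_eq H hs hq (h.tr none) h.h8
  exact ⟨h1, simple_of H hs hq h1 h2⟩

theorem concl_om {H : Subgroup (Perm Om)} {B : Finset (Om → Bool)} (h : Hyp H B) (hs : sg ∈ H) :
    Concl H := by
  obtain ⟨k, hk | hk⟩ := cls h hs
  · exact concl_of_blk h hs k hk
  · have h' := h.map nu
    have hs' : sg ∈ H.map (Equiv.permCongrHom nu).toMonoidHom := by
      refine ⟨sg⁻¹, H.inv_mem hs, ?_⟩
      have : ∀ x, nu (sg⁻¹ (nu.symm x)) = sg x := by decide +kernel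
      ext1 x
      simpa [Equiv.permCongrHom, Equiv.permCongr_apply] using this x
    have := concl_of_blk h' hs' k (by
      rw [Finset.mem_map]
      refine ⟨_, hk, ?_⟩
      funext x
      change blk k (nu (nu.symm x)) = _
      rw [Equiv.apply_symm_apply])
    exact this.congr (H.equivMapOfInjective _ (Equiv.permCongrHom nu).injective).symm

theorem concl_gen {Ω : Type*} [Fintype Ω] [DecidableEq Ω] {H : Subgroup (Perm Ω)}
    {B : Finset (Ω → Bool)} (h : Hyp H B) (h11 : 11 ∣ Nat.card H) : Concl H := by
  classical
  have : Fact (Nat.Prime 11) := ⟨by norm_num⟩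
  obtain ⟨⟨g, hgH⟩, hg⟩ := exists_prime_orderOf_dvd_card' 11 h11
  rw [Subgroup.orderOf_mk] at hg
  let e0 : Ω ≃ Om := Fintype.equivOfCardEq (by rw [h.card, card_om])
  let g0 : Perm Om := Equiv.permCongrHom e0 g
  have hct : ∀ t : Perm Om, orderOf t = 11 → t.cycleType = {11} := by
    intro t ht
    obtain ⟨n, hn⟩ := Equiv.Perm.cycleType_prime_order (σ := t) (by rw [ht]; norm_num)
    have h1 := t.sum_cycleType
    have h2 : t.support.card ≤ 12 := by rw [← card_om]; exact Finset.card_le_univ _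
    rw [hn, Multiset.sum_replicate, ht, smul_eq_mul] at h1
    have : n = 0 := by omega
    rw [hn, this, ht]; rfl
  have hg0 : orderOf g0 = 11 := by
    rw [← hg]; exact (Equiv.permCongrHom e0).orderOf_eq g
  have hc : IsConj g0 sg := by
    rw [Equiv.Perm.isConj_iff_cycleType_eq, hct _ hg0, hct _ sg_order]
  obtain ⟨c, hc⟩ := isConj_iff.1 hc
  have h1 := (h.map e0).map c
  have h2 := concl_om h1 (by
    refine ⟨g0, ⟨g, hgH, rfl⟩, ?_⟩
    rw [← hc]; rfl)
  exact ((h2.congr (Subgroup.equivMapOfInjective _ _ (Equiv.permCongrHom c).injective).symm)).congr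
    (H.equivMapOfInjective _ (Equiv.permCongrHom e0).injective).symm
end M11

namespace M11

theorem rel {E : Type*} [Field E] [Algebra ℚ E] (x : E) (hx : x ≠ 0) :
    16 * aeval x f2 = x ^ 12 * ev x⁻¹ F0 := by
  have : CharZero E := algebraRat.charZero E
  simp only [f2, F0, ev, map_sub, map_mul, map_pow, aeval_X, aeval_C, map_one, map_ofNat]
  simp only [map_div₀, map_one, map_ofNat]
  field_simp
  push_cast
  ring

theorem rel0 {E : Type*} [Field E] [Algebra ℚ E] (x : E) (h : aeval x f2 = 0) : x ≠ 0 := by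
  have : CharZero E := algebraRat.charZero E
  rintro rfl
  simp [f2] at h

theorem rel_iff {E : Type*} [Field E] [Algebra ℚ E] (x : E) (hx : x ≠ 0) :
    aeval x f2 = 0 ↔ ev x⁻¹ F0 = 0 := by
  have : CharZero E := algebraRat.charZero E
  have h := rel x hx
  constructor
  · intro h1
    rw [h1, mul_zero] at h
    rcases mul_eq_zero.1 h.symm with h2 | h2
    · exact absurd h2 (pow_ne_zero _ hx)
    · exact h2
  · intro h1
    rw [h1, mul_zero] at h
    rcases mul_eq_zero.1 h with h2 | h2
    · exact absurd h2 (by norm_num)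
    · exact h2

theorem F0_nz {E : Type*} [Field E] [CharZero E] (r : E) (h : ev r F0 = 0) : r ≠ 0 := by
  rintro rfl
  simp [F0, ev] at h

/-- generic: a monic integer list irreducible over ℤ gives the minimal polynomial -/
theorem ev_irrQ (F t : List ℤ) (hF : F = t ++ [1]) (h : Irreducible (ev (X : ℤ[X]) F)) :
    Irreducible (ev (X : ℚ[X]) F) := by
  have h1 := ((ev_list_monic (R := ℤ) F t hF).1.irreducible_iff_irreducible_map_fraction_map
    (K := ℚ)).1 h
  have h2 : (ev (X : ℤ[X]) F).map (algebraMap ℤ ℚ) = ev (X : ℚ[X]) F := by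
    have := map_ev (X : ℤ[X]) (mapRingHom (algebraMap ℤ ℚ)) F
    simpa using this
  rwa [h2] at h1

theorem aeval_ev {A : Type*} [CommRing A] {E : Type*} [CommRing E] [Algebra A E] (x : E) (F : List ℤ) :
    aeval x (ev (X : A[X]) F) = ev x F := by
  rw [map_ev]; simp

theorem ev_minpoly {E : Type*} [Field E] [Algebra ℚ E] (F t : List ℤ) (hF : F = t ++ [1])
    (h : Irreducible (ev (X : ℤ[X]) F)) (x : E) (hx : ev x F = 0) :
    minpoly ℚ x = ev (X : ℚ[X]) F :=
  (minpoly.eq_of_irreducible_of_monic (ev_irrQ F t hF h) (by rw [aeval_ev, hx])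
    (ev_list_monic F t hF).1).symm

theorem F0_eq : F0 = [16,-96,159,-115,195,-546,1031,-1269,945,-410,69,21] ++ [1] := rfl
theorem FT_eq : FT = [-3673,-1623,37836,-49905,25320,-7149,2826,-1197,270,-55,12,-3] ++ [1] := rfl

theorem f2_monic : f2.Monic ∧ f2.natDegree = 12 := by
  have h : f2 = X ^ 12 + (f2 - X ^ 12) := by ring
  have h2 : f2 - X ^ 12 = C (-6) * X ^ 11 + C (159/16) * X ^ 10 + C (-115/16) * X ^ 9 +
    C (195/16) * X ^ 8 + C (-546/16) * X ^ 7 + C (1031/16) * X ^ 6 + C (-1269/16) * X ^ 5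
    + C (945/16) * X ^ 4 + C (-410/16) * X ^ 3 + C (69/16) * X ^ 2 + C (21/16) * X + C (1/16) := by
    apply Polynomial.funext
    intro r
    simp [f2]
    ring
  have h3 : (f2 - X ^ 12).degree < ((12 : ℕ) : WithBot ℕ) := by
    rw [h2]
    have : (C (-6) * X ^ 11 + C (159/16) * X ^ 10 + C (-115/16) * X ^ 9 +
    C (195/16) * X ^ 8 + C (-546/16) * X ^ 7 + C (1031/16) * X ^ 6 + C (-1269/16) * X ^ 5
    + C (945/16) * X ^ 4 + C (-410/16) * X ^ 3 + C (69/16) * X ^ 2 + C (21/16) * X + C (1/16) :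
      ℚ[X]).degree ≤ 11 := by compute_degree
    exact lt_of_le_of_lt this (by norm_num)
  rw [h]
  refine ⟨monic_X_pow_add h3, ?_⟩
  refine natDegree_eq_of_degree_eq_some ?_
  rw [degree_add_eq_left_of_degree_lt (by rwa [degree_X_pow]), degree_X_pow]

theorem f2_irr : Irreducible f2 := by
  obtain ⟨hm, hd⟩ := f2_monic
  obtain ⟨x, hx⟩ := IsAlgClosed.exists_aeval_eq_zero (AlgebraicClosure ℚ) f2 (by
    rw [Polynomial.degree_eq_natDegree hm.ne_zero, hd]; norm_num)
  have hx0 := rel0 x hx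
  have hr := (rel_iff x hx0).1 hx
  have hint : IsIntegral ℚ x := ⟨f2, hm, hx⟩
  have h1 : (minpoly ℚ x⁻¹).natDegree = 12 := by
    rw [ev_minpoly F0 _ F0_eq irrF0 _ hr, (ev_list_monic F0 _ F0_eq).2]; rfl
  have h2 : (minpoly ℚ x).natDegree = 12 := by
    rw [← h1, ← IntermediateField.adjoin.finrank hint,
      ← IntermediateField.adjoin.finrank (IsIntegral.inv hint)]
    have : IntermediateField.adjoin ℚ {x} = IntermediateField.adjoin ℚ {x⁻¹} := by
      apply le_antisymm
      · rw [IntermediateField.adjoin_simple_le_iff]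
        have := inv_mem (IntermediateField.mem_adjoin_simple_self ℚ x⁻¹)
        rwa [inv_inv] at this
      · rw [IntermediateField.adjoin_simple_le_iff]
        exact inv_mem (IntermediateField.mem_adjoin_simple_self ℚ x)
    rw [this]
  have h3 : f2 = minpoly ℚ x :=
    (Polynomial.eq_of_monic_of_dvd_of_natDegree_le (minpoly.monic hint) hm (minpoly.dvd ℚ x hx)
      (by rw [h2, hd]))
  rw [h3]; exact minpoly.irreducible hint
end M11

namespace M11

def gT : List ℤ := [-19600, 173600, -395600, 319200, -146400, 51000, -21180, 5940, -1440, 260, -25]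
def N0 : List (List ℤ) := [[1847486345664580227571440,-4017536653658314876888400,3217345438333683378090320,-1457165088186994268836600,513668588570019427872460,-211415594939017167325900,59230256669829935435620,-14300780848831413159720,2563319324901769805238,-245196969048603599377,9771690480229891731],
  [-6111564482822473831747920,18603042707822719333678400,-16081604219424036271075440,7575235516288874238294560,-2591090295917179317002840,1107576454283338839824360,-313001194904312862568880,76792508734939116143500,-14124055527814462380136,1375545330820252836090,-55546524932828358646],
  [7942348532383150809030800,-26510690690911193352087600,23234715936281849765932880,-10978986672339861900626440,3745239130772837783625260,-1608299144913957776457380,454968933711394662400540,-111862854145312428520040,20631476084050693948982,-2012772456238319301127,81370316656391589617],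
  [-4676959511704000467702000,9002013054985850918944800,-6603063498078336679390560,2834065247889874121131120,-1039917069284849736414560,407439767984576753979560,-112879756258546709828200,26687962110789927666040,-4601742732053070326044,427461004514299792918,-16648701847711355898],
  [676561271757373690601200,3587336022402698357005200,-4439532823313960877866480,2351481553421837149412680,-736885385754832281088940,353073048978546233036420,-102094254592838367368740,26121411262711263515240,-5115262646966952076142,518743931029129743511,-21544976531959953233],
  [239184372933087303558480],
  [22779464088865457481760]]
def N1 : List (List ℤ) := [[-5983699870116530602549600,20185380016486204468281480,-17664479258388730956173720,8341354867710818482203080,-2848743170519398239811920,1221937961270077561601840,-345518039254852570076474,84937490856548174307316,-15649458228423788075258,1525355355332768290744,-61612518641196100144],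
  [14506330085412633321786800,-43265185347577067859595600,37021219709572400948989000,-17290010878493966541896320,5950950757993378089016740,-2526702997831344757229760,712792735316494128192840,-174519780036208603012776,31943343622719451001504,-3099291033762512107119,124763429352336129479],
  [-16582857238330343311512000,45937066769979417313611000,-38765355431232118467563400,17956549151012361105935760,-6215205534396482787814960,2619667925412862027669680,-737755680811026732820530,180122652567491875971752,-32812011433571443903392,3172838502717660434208,-127400170131326487398],
  [16115075175645726449307600,-54963199484950599120315600,48412048457635990252018600,-22832474986294746360313960,7798066178752674185277340,-3346496364905399848239360,946332701745230945647620,-232752869401574343738004,42901516421586783206342,-4182299912889082802117,168939161381763155311],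
  [-6774656875979984249132000,27453435630669026623228200,-24872961173442063319037400,11862835316821015662565200,-4017682472317555400104640,1743781099782194690482600,-494371477008535378698070,122140839138171655869808,-22672784529717316795280,2220886342295072427768,-90022227410821145290],
  [-1568475783382655307958000,6185408995215442233458560,-5583780865085765177122840,2661271788733983832657600,-902198838864271987681300,391126987036313005742320,-110862208258289660272828,27375002916621506994596,-5077455619463101646464,497093653597005634155,-20141985098234035435]]

def ev2 {R : Type*} [CommRing R] (y x : R) : List (List ℤ) → R
  | [] => 0
  | c :: l => ev y c + x * ev2 y x l

def ladd2 : List (List ℤ) → List (List ℤ) → List (List ℤ)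
  | [], b => b
  | a :: l, [] => a :: l
  | a :: l, b :: m => ladd a b :: ladd2 l m

def lsc2 (c : List ℤ) : List (List ℤ) → List (List ℤ)
  | [] => []
  | a :: l => lmul c a :: lsc2 c l

def lmul2 : List (List ℤ) → List (List ℤ) → List (List ℤ)
  | [], _ => []
  | a :: l, b => ladd2 (lsc2 a b) ([] :: lmul2 l b)

def lemb : List ℤ → List (List ℤ)
  | [] => []
  | a :: l => [a] :: lemb l

def lz2 (n : ℕ) (t : List ℤ) : List (List ℤ) → Bool
  | [] => true
  | a :: l => lzero 0 (lrem n t a) && lz2 n t l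

section
variable {R : Type*} [CommRing R] (y x : R)

theorem ev2_add (a b : List (List ℤ)) : ev2 y x (ladd2 a b) = ev2 y x a + ev2 y x b := by
  induction a generalizing b with
  | nil => simp [ladd2, ev2]
  | cons c l ih =>
    cases b with
    | nil => simp [ladd2, ev2]
    | cons d m => simp [ladd2, ev2, ih, ev_add]; ring

theorem ev2_sc (c : List ℤ) (a : List (List ℤ)) : ev2 y x (lsc2 c a) = ev y c * ev2 y x a := by
  induction a with
  | nil => simp [lsc2, ev2]
  | cons d l ih => simp [lsc2, ev2, ih, ev_mul]; ring

theorem ev2_mul (a b : List (List ℤ)) : ev2 y x (lmul2 a b) = ev2 y x a * ev2 y x b := by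
  induction a with
  | nil => simp [lmul2, ev2]
  | cons d l ih => simp [lmul2, ev2, ev2_add, ev2_sc, ih, ev]; ring

theorem ev2_emb (a : List ℤ) : ev2 y x (lemb a) = ev x a := by
  induction a with
  | nil => rfl
  | cons d l ih => simp [lemb, ev2, ih, ev]

theorem ev2_zero (n : ℕ) (t : List ℤ) (ht : t.length ≤ n) (hy : y ^ n + ev y t = 0)
    (a : List (List ℤ)) (h : lz2 n t a = true) : ev2 y x a = 0 := by
  induction a with
  | nil => rfl
  | cons d l ih =>
    simp only [lz2, Bool.and_eq_true] at h
    rw [ev2, ih h.2, ← ev_rem y n t ht hy d, ev_zero y 0 (by simp) _ h.1]; simp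

theorem map_ev2 {S F : Type*} [CommRing S] [FunLike F R S] [RingHomClass F R S] (f : F)
    (a : List (List ℤ)) : f (ev2 y x a) = ev2 (f y) (f x) a := by
  induction a with
  | nil => simp [ev2]
  | cons c l ih => simp [ev2, ih, map_ev]
end

theorem ev2_deg {R : Type*} [CommRing R] (y : R) (a : List (List ℤ)) (n : ℕ)
    (h : a.length ≤ n + 1) : (ev2 (C y) (X : R[X]) a).natDegree ≤ n := by
  induction a generalizing n with
  | nil => simp [ev2]
  | cons c l ih =>
    have h0 : ev (C y) c = C (ev y c) := (map_ev y C c).symm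
    rw [ev2, h0]
    cases n with
    | zero =>
      have : l = [] := by
        cases l with
        | nil => rfl
        | cons d m => simp at h
      subst this; simp [ev2]
    | succ n =>
      have := ih n (by simpa using h)
      refine (natDegree_add_le _ _).trans (max_le (by simp) ?_)
      refine natDegree_mul_le.trans ?_
      have := natDegree_X_le (R := R)
      omega

def dl : ℤ := 22779464088865457481760

theorem key_id {R : Type*} [CommRing R] (w x : R) (hw : (w ^ 2) ^ 11 + ev (w ^ 2) gT = 0) :
    (ev2 (w ^ 2) x N0 + w * ev2 (w ^ 2) x N1) * (ev2 (w ^ 2) x N0 - w * ev2 (w ^ 2) x N1) =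
    (dl : R) ^ 2 * ev x F0 := by
  have h := ev2_zero (w ^ 2) x 11 gT (by decide) hw
    (ladd2 (ladd2 (lmul2 N0 N0) (lsc2 [0, -1] (lmul2 N1 N1))) (lsc2 [-dl ^ 2] (lemb F0)))
    (by decide +kernel)
  rw [ev2_add, ev2_add, ev2_mul, ev2_sc, ev2_mul, ev2_sc, ev2_emb] at h
  simp only [ev] at h
  push_cast at h
  linear_combination h

section
variable {E : Type*} [Field E] [IsAlgClosed E] [Algebra ℚ E]

noncomputable def Pw (w : E) : E[X] :=
  ev2 (C (w ^ 2)) X N0 + C w * ev2 (C (w ^ 2)) X N1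

theorem Pw_mul (w : E) (hw : (w ^ 2) ^ 11 + ev (w ^ 2) gT = 0) :
    Pw w * Pw (-w) = C ((dl : E) ^ 2) * ev X F0 := by
  have := key_id (C w) (X : E[X]) (by
    have := congrArg C hw
    rw [map_add, map_pow, map_ev] at this
    simpa using this)
  rw [Pw, Pw]
  simp only [even_two.neg_pow, map_neg, map_pow, neg_mul, ← sub_eq_add_neg]
  rw [this]; simp

theorem Pw_deg (w : E) (hw : (w ^ 2) ^ 11 + ev (w ^ 2) gT = 0) : (Pw w).natDegree = 6 := by
  have : CharZero E := algebraRat.charZero E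
  have hle : ∀ w : E, (Pw w).natDegree ≤ 6 := by
    intro w
    refine (natDegree_add_le _ _).trans (max_le (ev2_deg _ _ 6 (by decide)) ?_)
    refine natDegree_mul_le.trans ?_
    have := ev2_deg (w ^ 2) N1 5 (by decide)
    rw [natDegree_C]; omega
  have hm := ev_list_monic (R := E) F0 _ F0_eq
  have hd : (dl : E) ^ 2 ≠ 0 := pow_ne_zero _ (by simp [dl])
  have h := congrArg natDegree (Pw_mul w hw)
  rw [natDegree_C_mul hd, hm.2] at h
  have h0 : Pw w * Pw (-w) ≠ 0 := by
    rw [Pw_mul w hw]; exact mul_ne_zero (by simpa using hd) hm.1.ne_zero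
  rw [natDegree_mul (left_ne_zero_of_mul h0) (right_ne_zero_of_mul h0)] at h
  have h1 := hle w
  have h2 := hle (-w)
  simp at h
  omega

theorem F0_sep : (ev (X : E[X]) F0).Separable := by
  have h1 := (ev_irrQ F0 _ F0_eq irrF0).separable
  have h2 := h1.map (f := algebraMap ℚ E)
  have h3 : (ev (X : ℚ[X]) F0).map (algebraMap ℚ E) = ev (X : E[X]) F0 := by
    have := map_ev (X : ℚ[X]) (mapRingHom (algebraMap ℚ E)) F0
    simpa using this
  rwa [h3] at h2

theorem Pw_mul_sep (w : E) (hw : (w ^ 2) ^ 11 + ev (w ^ 2) gT = 0) :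
    (Pw w * Pw (-w)).Separable := by
  have : CharZero E := algebraRat.charZero E
  have hd : (dl : E) ^ 2 ≠ 0 := pow_ne_zero _ (by simp [dl])
  rw [Pw_mul w hw]
  exact F0_sep.unit_mul (isUnit_C.2 (isUnit_iff_ne_zero.2 hd))

theorem Pw_eval (w x : E) (hw : (w ^ 2) ^ 11 + ev (w ^ 2) gT = 0) :
    (Pw w).eval x * (Pw (-w)).eval x = (dl : E) ^ 2 * ev x F0 := by
  rw [← eval_mul, Pw_mul w hw, eval_mul, eval_C]
  congr 1
  have := map_ev (X : E[X]) (evalRingHom x) F0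
  simpa using this

theorem Pw_iff (w x : E) (hw : (w ^ 2) ^ 11 + ev (w ^ 2) gT = 0) (hx : ev x F0 = 0) :
    (Pw (-w)).eval x = 0 ↔ (Pw w).eval x ≠ 0 := by
  have h := Pw_eval w x hw
  rw [hx, mul_zero] at h
  constructor
  · intro h1 h2
    obtain ⟨a, b, hab⟩ := (Pw_mul_sep w hw).isCoprime
    have := congrArg (eval x) hab
    simp [h1, h2] at this
  · intro h1
    rcases mul_eq_zero.1 h with h2 | h2
    · exact absurd h2 h1
    · exact h2

theorem Pw_root (w x : E) (hw : (w ^ 2) ^ 11 + ev (w ^ 2) gT = 0) (hx : (Pw w).eval x = 0) :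
    ev x F0 = 0 := by
  have : CharZero E := algebraRat.charZero E
  have h := Pw_eval w x hw
  rw [hx, zero_mul] at h
  have hd : (dl : E) ^ 2 ≠ 0 := pow_ne_zero _ (by simp [dl])
  rcases mul_eq_zero.1 h.symm with h2 | h2
  · exact absurd h2 hd
  · exact h2

open Classical in
theorem Pw_six (w : E) (hw : (w ^ 2) ^ 11 + ev (w ^ 2) gT = 0) :
    (Finset.univ.filter fun x : f2.rootSet E => (Pw w).eval (x.1)⁻¹ = 0).card = 6 := by
  have : CharZero E := algebraRat.charZero E
  have hne : Pw w ≠ 0 := by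
    intro h; have := Pw_deg w hw; rw [h] at this; simp at this
  have h1 : (Pw w).roots.toFinset.card = 6 := by
    rw [Multiset.toFinset_card_of_nodup (nodup_roots (Pw_mul_sep w hw).of_mul_left),
      ← (IsAlgClosed.splits (Pw w)).natDegree_eq_card_roots, Pw_deg w hw]
  rw [← h1]
  apply Finset.card_bij (fun x _ => (x.1)⁻¹)
  · intro x hx
    rw [Finset.mem_filter] at hx
    rw [Multiset.mem_toFinset, mem_roots hne]; exact hx.2
  · intro x _ y _ h; exact Subtype.ext (inv_injective h)
  · intro r hr
    rw [Multiset.mem_toFinset, mem_roots hne] at hr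
    have h2 := Pw_root w r hw hr
    have h3 := F0_nz r h2
    refine ⟨⟨r⁻¹, ?_⟩, ?_, by simp⟩
    · rw [mem_rootSet]
      refine ⟨f2_monic.1.ne_zero, ?_⟩
      rw [rel_iff _ (inv_ne_zero h3), inv_inv, h2]
    · rw [Finset.mem_filter]; refine ⟨Finset.mem_univ _, ?_⟩
      simp only [inv_inv]; exact hr

noncomputable def gP : E[X] := (X ^ 2) ^ 11 + ev (X ^ 2) gT

theorem gP_eval (w : E) : (gP (E := E)).eval w = (w ^ 2) ^ 11 + ev (w ^ 2) gT := by
  have := map_ev (X ^ 2 : E[X]) (evalRingHom w) gT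
  simp only [coe_evalRingHom, eval_pow, eval_X] at this
  simp [gP, this]

theorem gP_deg : (gP (E := E)).natDegree = 22 := by
  have : CharZero E := algebraRat.charZero E
  rw [gP]; simp only [gT, ev]
  compute_degree!

open Classical in
noncomputable def bw (w : E) : f2.rootSet E → Bool := fun x => decide ((Pw w).eval (x.1)⁻¹ = 0)

open Classical in
noncomputable def BB : Finset (f2.rootSet E → Bool) := (gP (E := E)).roots.toFinset.image bw

theorem mem_BB (b : f2.rootSet E → Bool) :
    b ∈ BB ↔ ∃ w : E, (w ^ 2) ^ 11 + ev (w ^ 2) gT = 0 ∧ bw w = b := by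
  have : CharZero E := algebraRat.charZero E
  have hne : (gP (E := E)) ≠ 0 := by
    intro h; have := gP_deg (E := E); rw [h] at this; simp at this
  simp only [BB, Finset.mem_image, Multiset.mem_toFinset, mem_roots hne, IsRoot.def, gP_eval]

end
end M11

namespace M11

theorem map_Pw {E : Type*} [Field E] (φ : E →+* E) (w x : E) :
    φ ((Pw w).eval x) = (Pw (φ w)).eval (φ x) := by
  have h : ∀ (w x : E), (Pw w).eval x = ev2 (w ^ 2) x N0 + w * ev2 (w ^ 2) x N1 := by
    intro w x
    have h1 := map_ev2 (C (w ^ 2)) X (evalRingHom x) N0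
    have h2 := map_ev2 (C (w ^ 2)) X (evalRingHom x) N1
    simp only [coe_evalRingHom, eval_C, eval_X] at h1 h2
    rw [Pw, eval_add, eval_mul, eval_C, h1, h2]
  rw [h, h, map_add, map_mul, map_ev2, map_ev2, map_pow]

theorem dvd_card' (L : Type) [Field L] [NumberField L] [i : Algebra ℚ L] [IsGalois ℚ L]
    (x : L) (hr : ev x F0 = 0) : 11 ∣ Nat.card Gal(L/ℚ) ∧ 8 ∣ Nat.card Gal(L/ℚ) := by
  have : i = DivisionRing.toRatAlgebra := Subsingleton.elim _ _
  subst this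
  refine dvd_card L ?_
  have h1 := Normal.splits (inferInstance : Normal ℚ L) x
  rw [ev_minpoly F0 _ F0_eq irrF0 _ hr] at h1
  have h3 : (ev (X : ℚ[X]) F0).map (algebraMap ℚ L) = ev (X : L[X]) F0 := by
    have := map_ev (X : ℚ[X]) (mapRingHom (algebraMap ℚ L)) F0
    simpa using this
  rwa [h3] at h1

theorem nf_of (L : Type) [Field L] [i : Algebra ℚ L] (h : Module.Finite ℚ L) (hc : CharZero L) :
    NumberField L := by
  have : i = DivisionRing.toRatAlgebra := Subsingleton.elim _ _
  subst this
  exact @NumberField.mk L _ hc h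

theorem dvd_gal_aux (L : Type) [Field L] [i : Algebra ℚ L] [hs : IsSplittingField ℚ L f2] :
    11 ∣ Nat.card Gal(L/ℚ) ∧ 8 ∣ Nat.card Gal(L/ℚ) := by
  have hirr := f2_irr
  have h1 : IsGalois ℚ L := IsGalois.of_separable_splitting_field hirr.separable
  have h2 : CharZero L := charZero_of_injective_algebraMap (algebraMap ℚ L).injective
  have h3 : Module.Finite ℚ L := IsSplittingField.finiteDimensional _ f2
  have : NumberField L := nf_of L h3 h2
  obtain ⟨x, hx⟩ := (hs.splits).exists_eval_eq_zero (by
    rw [degree_map, degree_eq_natDegree hirr.ne_zero, f2_monic.2]; norm_num)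
  rw [eval_map_algebraMap] at hx
  have hr := (rel_iff x (rel0 x hx)).1 hx
  exact dvd_card' L x⁻¹ hr

theorem dvd_gal : 11 ∣ Nat.card f2.Gal ∧ 8 ∣ Nat.card f2.Gal :=
  @dvd_gal_aux f2.SplittingField _ _ (IsSplittingField.splittingField f2)

theorem gal_concl_aux (E : Type) [Field E] [Algebra ℚ E] [IsAlgClosed E] [Normal ℚ E] : Concl f2.Gal := by
  classical
  have hsp : Fact ((f2.map (algebraMap ℚ E)).Splits) := ⟨IsAlgClosed.splits _⟩
  let φ := Gal.galActionHom f2 E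
  have hinj : Function.Injective φ := Gal.galActionHom_injective f2 E
  have hcard : Nat.card φ.range = Nat.card f2.Gal :=
    (Nat.card_congr (MonoidHom.ofInjective hinj).toEquiv).symm
  have hirr := f2_irr
  have hd := dvd_gal
  have hyp : Hyp φ.range (BB (E := E)) := by
    constructor
    · rw [card_rootSet_eq_natDegree hirr.separable (IsAlgClosed.splits _), f2_monic.2]
    · intro x y
      have := Gal.galAction_isPretransitive f2 E hirr
      obtain ⟨g, hg⟩ := MulAction.exists_smul_eq f2.Gal x y
      exact ⟨φ g, ⟨g, rfl⟩, hg⟩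
    · rw [hcard]; exact hd.2
    · obtain ⟨w, hw⟩ := IsAlgClosed.exists_root (gP (E := E)) (by
        intro h
        have := natDegree_eq_of_degree_eq_some h
        rw [gP_deg] at this; simp at this)
      rw [IsRoot.def, gP_eval] at hw
      exact ⟨bw w, (mem_BB _).2 ⟨w, hw, rfl⟩⟩
    · refine Finset.card_image_le.trans ((Multiset.toFinset_card_le _).trans ?_)
      rw [← gP_deg (E := E)]; exact card_roots' _
    · intro b hb
      obtain ⟨w, hw, rfl⟩ := (mem_BB _).1 hb
      rw [← Pw_six w hw]
      congr 1; ext x; simp only [Finset.mem_filter, bw, decide_eq_true_iff]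
    · intro b hb
      obtain ⟨w, hw, rfl⟩ := (mem_BB _).1 hb
      refine (mem_BB _).2 ⟨-w, by rwa [even_two.neg_pow], ?_⟩
      funext x
      have hx := x.2
      rw [mem_rootSet] at hx
      have hr := (rel_iff x.1 (rel0 _ hx.2)).1 hx.2
      have := Pw_iff w _ hw hr
      simp only [bw, ← decide_not]
      exact decide_eq_decide.2 this
    · rintro _ ⟨g, rfl⟩ b hb
      obtain ⟨w, hw, rfl⟩ := (mem_BB _).1 hb
      obtain ⟨ψ, rfl⟩ := Gal.restrict_surjective f2 E g
      refine (mem_BB _).2 ⟨ψ.symm w, ?_, ?_⟩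
      · have := congrArg ψ.symm hw
        rwa [map_add, map_pow, map_ev, map_zero, map_pow] at this
      · funext x
        have hx : ((φ (Gal.restrict f2 E ψ) x : f2.rootSet E) : E) = ψ x.1 :=
          Gal.galActionHom_restrict f2 E ψ x
        simp only [bw]
        rw [hx]
        refine decide_eq_decide.2 ?_
        have := map_Pw (ψ : E →+* E) (ψ.symm w) (x.1)⁻¹
        simp only [RingHom.coe_coe, AlgEquiv.apply_symm_apply, map_inv₀] at this
        rw [← this]
        exact (map_eq_zero ψ).symm
  have h2 := concl_gen hyp (by rw [hcard]; exact hd.1)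
  exact h2.congr (MonoidHom.ofInjective hinj).symm

theorem gal_concl_k (k : Type) [Field k] [Algebra ℚ k] [Algebra.IsAlgebraic ℚ k] : Concl f2.Gal :=
  have : IsAlgClosure ℚ (AlgebraicClosure k) := inferInstance
  have : Normal ℚ (AlgebraicClosure k) := IsAlgClosure.normal _ _
  gal_concl_aux (AlgebraicClosure k)

theorem gal_concl : Concl f2.Gal := gal_concl_k ℚ
end M11

namespace M11
open NumberField Matrix

/-- list of coordinates as a function -/
def lco (l : List ℤ) (i : ℕ) : ℤ := l.getD i 0

theorem ev_sum {R : Type*} [CommRing R] (x : R) (n : ℕ) (l : List ℤ) (h : l.length ≤ n) :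
    ev x l = ∑ i : Fin n, (lco l i : R) * x ^ (i : ℕ) := by
  induction n generalizing l with
  | zero =>
    have : l = [] := List.length_eq_zero_iff.1 (by omega)
    subst this; simp [ev]
  | succ n ih =>
    cases l with
    | nil => simp [ev, lco]
    | cons c l =>
      rw [Fin.sum_univ_succ, ev, ih l (by simpa using h), Finset.mul_sum]
      congr 1
      · simp [lco]
      · refine Finset.sum_congr rfl fun i _ => ?_
        simp only [lco, Fin.val_succ, List.getD_cons_succ]; ring

/-- rows `y, xy, x²y, …` -/
def lrow (t : List ℤ) (y : List ℤ) : ℕ → List ℤ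
  | 0 => y
  | k + 1 => lrem 12 t (0 :: lrow t y k)

theorem lrow_ev {R : Type*} [CommRing R] (x : R) (t y : List ℤ) (ht : t.length ≤ 12)
    (hx : x ^ 12 + ev x t = 0) (k : ℕ) : ev x (lrow t y k) = ev x y * x ^ k := by
  induction k with
  | zero => simp [lrow]
  | succ k ih => rw [lrow, ev_rem x 12 t ht hx, ev, ih]; push_cast; ring

theorem lrow_length (t y : List ℤ) (ht : t.length ≤ 12) (hy : y.length ≤ 12) (k : ℕ) :
    (lrow t y k).length ≤ 12 := by
  cases k with
  | zero => exact hy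
  | succ k => exact lrem_length 12 t ht _

def lder (n : ℤ) : List ℤ → List ℤ
  | [] => []
  | a :: l => (n * a) :: lder (n + 1) l

theorem lder_length (n : ℤ) (l : List ℤ) : (lder n l).length = l.length := by
  induction l generalizing n with
  | nil => rfl
  | cons a l ih => simp [lder, ih]

theorem ev_lder (n : ℤ) (l : List ℤ) :
    ev (X : ℚ[X]) (lder n l) = derivative (X * ev (X : ℚ[X]) l) + ((n : ℚ[X]) - 1) * ev (X : ℚ[X]) l := by
  induction l generalizing n with
  | nil => simp [lder, ev]
  | cons a l ih =>
    simp only [lder, ev, ih, derivative_mul, derivative_X, derivative_add, derivative_intCast]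
    push_cast; ring

theorem det_idx (K : Type) [Field K] [NumberField K] (hK : Module.finrank ℚ K = 12) (c : ℤ) (F t l : List ℤ)
    (hF : F = t ++ [1]) (hl : F = c :: l) (ht : t.length = 12)
    (hirr : Irreducible (ev (X : ℤ[X]) F)) (x : 𝓞 K) (hx : ev (x : K) F = 0) :
    ∃ A : Matrix (Fin 12) (Fin 12) ℤ,
      A.det ^ 2 * discr K = (Matrix.of fun i j : Fin 12 => lco (lrow t (lder 1 l) i) j).det ∧
      (∀ v : Fin 12 → ℤ, ∀ p : ℤ, (∃ z : 𝓞 K, p * z = ∑ j, (v j : 𝓞 K) * x ^ (j : ℕ)) ↔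
        ∃ w : Fin 12 → ℤ, A *ᵥ v = p • w) := by
  have hmin := ev_minpoly F t hF hirr (x : K) hx
  have hxi : IsIntegral ℚ (x : K) := (x.isIntegral_coe).tower_top
  have hdeg : (minpoly ℚ (x : K)).natDegree = 12 := by
    rw [hmin, (ev_list_monic F t hF).2, ht]
  have hrank : Nat.card (Module.Free.ChooseBasisIndex ℤ (𝓞 K)) = 12 := by
    rw [Nat.card_eq_fintype_card, ← Module.finrank_eq_card_chooseBasisIndex, RingOfIntegers.rank, hK]
  let e : Module.Free.ChooseBasisIndex ℤ (𝓞 K) ≃ Fin 12 := Finite.equivFinOfCardEq hrank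
  let b := (RingOfIntegers.basis K).reindex e
  let bQ := (integralBasis K).reindex e
  have hbb : ∀ i, bQ i = (b i : K) := by
    intro i; simp [bQ, b, integralBasis_apply]
  let A : Matrix (Fin 12) (Fin 12) ℤ := fun i j => b.repr (x ^ (j : ℕ)) i
  have hA : ∀ j : Fin 12, x ^ (j : ℕ) = ∑ i, (A i j : 𝓞 K) * b i := by
    intro j
    have := (b.sum_repr (x ^ (j : ℕ))).symm
    simpa only [zsmul_eq_mul] using this
  refine ⟨A, ?_, ?_⟩
  · have htop : Algebra.adjoin ℚ {(x : K)} = ⊤ := by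
      have h1 : IntermediateField.adjoin ℚ {(x : K)} = ⊤ := by
        apply Field.primitive_element_iff_minpoly_natDegree_eq ℚ (x : K) |>.2
        rw [hdeg, hK]
      rw [← IntermediateField.adjoin_simple_toSubalgebra_of_isAlgebraic hxi.isAlgebraic, h1]; rfl
    let pb := PowerBasis.ofAdjoinEqTop hxi htop
    have hgen : pb.gen = (x : K) := PowerBasis.ofAdjoinEqTop_gen hxi htop
    have hdim : pb.dim = 12 := by rw [← pb.natDegree_minpoly, hgen, hdeg]
    let pB := pb.basis.reindex (finCongr hdim)
    have hpB : ∀ i, pB i = (x : K) ^ (i : ℕ) := by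
      intro i; simp [pB, hgen]
    have hd1 : Algebra.discr ℚ pB = (A.det : ℚ) ^ 2 * (discr K : ℚ) := by
      have h1 := Algebra.discr_of_matrix_vecMul (bQ : Fin 12 → K) (A.map (Int.cast : ℤ → ℚ))
      have h2 : ((bQ : Fin 12 → K) ᵥ* (A.map (Int.cast : ℤ → ℚ)).map (algebraMap ℚ K)) = pB := by
        funext j
        rw [hpB]
        have := congrArg (algebraMap (𝓞 K) K) (hA j)
        simp only [map_pow, map_sum, map_mul, map_intCast] at this
        rw [this]
        simp only [Matrix.vecMul, dotProduct, Matrix.map_apply, hbb]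
        refine Finset.sum_congr rfl fun i _ => ?_
        simp [mul_comm]
      rw [h2] at h1
      have h3 : Algebra.discr ℚ (bQ : Fin 12 → K) = discr K := by
        rw [coe_discr]
        simp only [bQ, Module.Basis.coe_reindex]
        exact Algebra.discr_reindex ℚ _ e
      have h4 : (A.map (Int.cast : ℤ → ℚ)).det = A.det := by
        have := (Int.castRingHom ℚ).map_det A
        simpa using this.symm
      rw [h1, h3, h4]
    have hd2 : Algebra.discr ℚ pB = Algebra.discr ℚ pb.basis := by
      simp only [pB, Module.Basis.coe_reindex]
      exact Algebra.discr_reindex ℚ _ _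
    have hd3 := Algebra.discr_powerBasis_eq_norm ℚ pb
    rw [hK] at hd3
    have hder : aeval (x : K) (derivative (ev (X : ℚ[X]) F)) = ev (x : K) (lder 1 l) := by
      have : derivative (ev (X : ℚ[X]) F) = ev X (lder 1 l) := by
        rw [ev_lder, hl]; simp [ev]
      rw [this, aeval_ev]
    rw [hgen, hmin, hder] at hd3
    have hll : l.length = 12 := by
      have := congrArg List.length (hF.symm.trans hl)
      simp at this; omega
    have hx' : (x : K) ^ 12 + ev (x : K) t = 0 := by
      rw [hF, ev_append, ht] at hx; simp [ev] at hx; linear_combination hx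
    have hd4 : Algebra.norm ℚ (ev (x : K) (lder 1 l)) =
        ((Matrix.of fun i j : Fin 12 => lco (lrow t (lder 1 l) i) j).det : ℤ) := by
      rw [Algebra.norm_eq_matrix_det pB, ← Matrix.det_transpose]
      have h5 : (Algebra.leftMulMatrix pB (ev (x : K) (lder 1 l)))ᵀ =
          (Matrix.of fun i j : Fin 12 => lco (lrow t (lder 1 l) i) j).map (Int.cast : ℤ → ℚ) := by
        ext i j
        rw [Matrix.transpose_apply, Algebra.leftMulMatrix_eq_repr_mul, hpB,
          ← lrow_ev (x : K) t _ ht.le hx', ev_sum (x : K) 12 _ (lrow_length t _ ht.le (by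
            rw [lder_length, hll]) _)]
        have : ∑ k : Fin 12, ((lco (lrow t (lder 1 l) i) k : ℤ) : K) * (x : K) ^ (k : ℕ) =
            ∑ k : Fin 12, ((lco (lrow t (lder 1 l) i) k : ℤ) : ℚ) • pB k := by
          refine Finset.sum_congr rfl fun k _ => ?_
          rw [hpB, Algebra.smul_def]; simp
        rw [this, Module.Basis.repr_sum_self]
        rfl
      rw [h5]
      have := (Int.castRingHom ℚ).map_det (Matrix.of fun i j : Fin 12 => lco (lrow t (lder 1 l) i) j)
      simpa using this.symm
    rw [← hd2, hd1, hd4] at hd3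
    have h66 : ((-1 : ℚ)) ^ (12 * (12 - 1) / 2) = 1 := by norm_num
    rw [h66, one_mul] at hd3
    exact_mod_cast hd3
  · intro v p
    have hsum : ∑ j, (v j : 𝓞 K) * x ^ (j : ℕ) = ∑ i, ((A *ᵥ v) i : ℤ) • b i := by
      simp only [hA, Finset.mul_sum]
      rw [Finset.sum_comm]
      refine Finset.sum_congr rfl fun i _ => ?_
      simp only [Matrix.mulVec, dotProduct, zsmul_eq_mul, Int.cast_sum, Finset.sum_mul]
      refine Finset.sum_congr rfl fun j _ => ?_
      push_cast; ring
    rw [hsum]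
    constructor
    · rintro ⟨z, hz⟩
      refine ⟨fun i => b.repr z i, ?_⟩
      funext i
      have := congrArg (fun y => b.repr y i) hz
      simp only [Module.Basis.repr_sum_self] at this
      rw [← this, ← zsmul_eq_mul, map_zsmul]; simp
    · rintro ⟨w, hw⟩
      refine ⟨∑ i, w i • b i, ?_⟩
      rw [hw, Finset.mul_sum]
      refine Finset.sum_congr rfl fun i _ => ?_
      simp only [Pi.smul_apply, smul_eq_mul, zsmul_eq_mul]; push_cast; ring

theorem det_dvd (A : Matrix (Fin 12) (Fin 12) ℤ) (p : ℕ) [Fact p.Prime] : (p : ℤ) ∣ A.det ↔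
    ∃ v : Fin 12 → ℤ, (∃ i, ¬ (p : ℤ) ∣ v i) ∧ ∃ w : Fin 12 → ℤ, A *ᵥ v = (p : ℤ) • w := by
  have h1 : (p : ℤ) ∣ A.det ↔ (A.map (Int.cast : ℤ → ZMod p)).det = 0 := by
    have := (Int.castRingHom (ZMod p)).map_det A
    have h2 : (A.map (Int.cast : ℤ → ZMod p)).det = (A.det : ZMod p) := by simpa using this.symm
    rw [h2, ZMod.intCast_zmod_eq_zero_iff_dvd]
  rw [h1, ← Matrix.exists_mulVec_eq_zero_iff]
  have key : ∀ v : Fin 12 → ℤ, (∃ w : Fin 12 → ℤ, A *ᵥ v = (p : ℤ) • w) ↔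
      A.map (Int.cast : ℤ → ZMod p) *ᵥ (fun i => (v i : ZMod p)) = 0 := by
    intro v
    have h : A.map (Int.cast : ℤ → ZMod p) *ᵥ (fun i => (v i : ZMod p)) =
        fun i => (((A *ᵥ v) i : ℤ) : ZMod p) := by
      funext i; simp [Matrix.mulVec, dotProduct]
    rw [h]
    constructor
    · rintro ⟨w, hw⟩; funext i; rw [hw]; simp
    · intro h
      have : ∀ i, ∃ w : ℤ, (A *ᵥ v) i = p * w := fun i =>
        (ZMod.intCast_zmod_eq_zero_iff_dvd _ _).1 (congrFun h i)
      choose w hw using this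
      exact ⟨w, funext fun i => by rw [hw]; rfl⟩
  constructor
  · rintro ⟨v, hv, hA⟩
    obtain ⟨i, hi⟩ := Function.ne_iff.1 hv
    have hl : ∀ i, (((v i).cast : ℤ) : ZMod p) = v i := fun i => ZMod.intCast_zmod_cast _
    refine ⟨fun i => (v i).cast, ⟨i, ?_⟩, (key _).2 ?_⟩
    · rw [← ZMod.intCast_zmod_eq_zero_iff_dvd, hl]; exact hi
    · simpa only [hl] using hA
  · rintro ⟨v, ⟨i, hi⟩, hw⟩
    refine ⟨fun i => (v i : ZMod p), ?_, (key v).1 hw⟩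
    intro h
    exact hi ((ZMod.intCast_zmod_eq_zero_iff_dvd _ _).1 (congrFun h i))

end M11

namespace M11

theorem dvd_lift {p : ℕ} (D : ℤ[X]) (h : D.map (Int.castRingHom (ZMod p)) = 0) :
    ∃ B : ℤ[X], D = (p : ℤ[X]) * B := by
  have : C (p : ℤ) ∣ D := by
    rw [C_dvd_iff_dvd_coeff]
    intro i
    have := congrArg (fun q => coeff q i) h
    simp only [coeff_map, coeff_zero, Int.coe_castRingHom] at this
    exact (ZMod.intCast_zmod_eq_zero_iff_dvd _ _).1 this
  obtain ⟨B, hB⟩ := this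
  exact ⟨B, by rw [hB]; simp⟩

/-- if `P ^ N ∈ (p, G)`, then `P ∈ (p, G)` -/
theorem rad_step {p : ℕ} [Fact p.Prime] (G P : ℤ[X]) (N : ℕ) (hN : N ≠ 0)
    (hsep : (G.map (Int.castRingHom (ZMod p))).Separable)
    (h : ∃ A B : ℤ[X], P ^ N = G * A + (p : ℤ[X]) * B) :
    ∃ A B : ℤ[X], P = G * A + (p : ℤ[X]) * B := by
  obtain ⟨A, B, h⟩ := h
  have h1 : G.map (Int.castRingHom (ZMod p)) ∣ (P.map (Int.castRingHom (ZMod p))) ^ N := by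
    refine ⟨A.map (Int.castRingHom (ZMod p)), ?_⟩
    have := congrArg (Polynomial.map (Int.castRingHom (ZMod p))) h
    simpa using this
  obtain ⟨Q, hQ⟩ := (hsep.squarefree.dvd_pow_iff_dvd hN).1 h1
  obtain ⟨A', rfl⟩ := Polynomial.map_surjective (Int.castRingHom (ZMod p))
    (ZMod.ringHom_surjective _) Q
  obtain ⟨B', hB⟩ := dvd_lift (p := p) (P - G * A') (by
    rw [Polynomial.map_sub, Polynomial.map_mul, hQ, sub_self])
  exact ⟨A', B', by rw [← hB]; ring⟩

theorem int_pow {O : Type*} [CommRing O] [Algebra.IsIntegral ℤ O] (p : ℕ) (y u : O)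
    (h : y = p * u) : ∃ n : ℕ, n ≠ 0 ∧ ∃ B : ℤ[X], y ^ n = p * aeval y B := by
  by_cases hO : Nontrivial O
  · obtain ⟨q, hq, hqu⟩ := Algebra.IsIntegral.isIntegral (R := ℤ) u
    have h0 : aeval (((algebraMap ℤ O) (p : ℤ)) * u) (scaleRoots q (p : ℤ)) = 0 :=
      scaleRoots_aeval_eq_zero hqu
    have h1 : ((algebraMap ℤ O) (p : ℤ)) * u = y := by rw [h]; simp
    rw [h1] at h0
    have h2 : C (p : ℤ) ∣ X ^ q.natDegree - scaleRoots q (p : ℤ) := by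
      rw [C_dvd_iff_dvd_coeff]
      intro i
      rw [coeff_sub, coeff_X_pow, coeff_scaleRoots]
      rcases lt_trichotomy i q.natDegree with hi | hi | hi
      · rw [if_neg hi.ne, zero_sub, dvd_neg]
        exact Dvd.dvd.mul_left (dvd_pow_self _ (by omega)) _
      · rw [if_pos hi, hi, hq.coeff_natDegree]; simp
      · rw [if_neg hi.ne', coeff_eq_zero_of_natDegree_lt hi]; simp
    obtain ⟨B, hB⟩ := h2
    refine ⟨q.natDegree, ?_, B, ?_⟩
    · intro hd
      rw [hq.natDegree_eq_zero.1 hd] at hqu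
      simp at hqu
    · have := congrArg (aeval y) hB
      rw [map_sub, h0, map_mul] at this
      simpa using this
  · have := not_nontrivial_iff_subsingleton.1 hO
    exact ⟨1, one_ne_zero, 0, Subsingleton.elim _ _⟩

section
variable {O : Type*} [CommRing O] [IsDomain O] [CharZero O] [Algebra.IsIntegral ℤ O] (t : O)
  (F : ℤ[X]) (hF : ∀ P : ℤ[X], aeval t P = 0 → F ∣ P) (hF0 : aeval t F = 0)
  {p : ℕ} [hp : Fact p.Prime] (G H T : ℤ[X]) (hGH : F = G * H + (p : ℤ[X]) * T)
  (hsep : (G.map (Int.castRingHom (ZMod p))).Separable)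
include hF hGH hsep

theorem mem_I (P : ℤ[X]) (m : ℕ) (hm : m ≠ 0) (u : O) (h : (aeval t P) ^ m = p * u) :
    ∃ A B : ℤ[X], P = G * A + (p : ℤ[X]) * B := by
  obtain ⟨n, hn, B, hB⟩ := int_pow p _ u h
  rw [← pow_mul] at hB
  refine rad_step G P (m * n) (mul_ne_zero hm hn) hsep ?_
  have h1 : aeval t (P ^ (m * n) - (p : ℤ[X]) * B.comp (P ^ m)) = 0 := by
    rw [map_sub, map_pow, hB, map_mul, aeval_comp, map_pow]; simp
  obtain ⟨Q, hQ⟩ := hF _ h1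
  exact ⟨H * Q, T * Q + B.comp (P ^ m), by linear_combination hQ + Q * hGH⟩

include hF0
theorem dede_step (a b c d e : ℤ[X]) (h1 : a * G + b * H + c * T + (p : ℤ[X]) * d + F * e = 1)
    (m : ℕ) (hm0 : m ≠ 0) (D : ℤ[X]) (hm : (aeval t G) ^ m = p * aeval t D) (w : O) (Y V : ℤ[X])
    (hY : p * w = aeval t Y) (hV : aeval t G * w = aeval t V) : ∃ Z : ℤ[X], w = aeval t Z := by
  obtain ⟨y2, y1, hy⟩ := mem_I t F hF G H T hGH hsep Y 1 one_ne_zero w (by rw [pow_one, hY])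
  obtain ⟨v2, v1, hv⟩ := mem_I t F hF G H T hGH hsep V m hm0 (aeval t D * w ^ m) (by
    rw [← hV, mul_pow, hm]; ring)
  refine ⟨a * V + b * (H * y1 - T * y2) - c * (H * v1 - T * v2) + d * Y, ?_⟩
  have hp0 : (p : O) ≠ 0 := Nat.cast_ne_zero.2 hp.out.ne_zero
  apply mul_left_cancel₀ hp0
  have e0 := congrArg (aeval t) hGH
  have e1 := congrArg (aeval t) h1
  have e2 := congrArg (aeval t) hy
  have e3 := congrArg (aeval t) hv
  simp only [map_add, map_mul, map_one, map_natCast, map_sub, hF0] at e0 e1 e2 e3 ⊢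
  set g := aeval t G
  linear_combination -(p * w) * e1 + p * (aeval t a) * hV + (aeval t b) * (aeval t H) * hY
    + (aeval t b) * (aeval t H) * e2 - (aeval t b) * (aeval t y2) * e0 - (aeval t c) * w * e0
    - (aeval t c) * (aeval t H) * hV - (aeval t c) * (aeval t H) * e3
    + (aeval t c) * (aeval t v2) * e0 + p * (aeval t d) * hY

theorem dedekind (a b c d e : ℤ[X]) (h1 : a * G + b * H + c * T + (p : ℤ[X]) * d + F * e = 1)
    (m : ℕ) (hm0 : m ≠ 0) (D : ℤ[X]) (hm : (aeval t G) ^ m = p * aeval t D) (w : O) (Y : ℤ[X])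
    (hY : p * w = aeval t Y) : ∃ Z : ℤ[X], w = aeval t Z := by
  have key : ∀ k : ℕ, (∃ Z : ℤ[X], (aeval t G) ^ k * w = aeval t Z) → ∃ Z : ℤ[X], w = aeval t Z := by
    intro k
    induction k with
    | zero => simp
    | succ k ih =>
      rintro ⟨Z, hZ⟩
      apply ih
      refine dede_step t F hF hF0 G H T hGH hsep a b c d e h1 m hm0 D hm _ (G ^ k * Y) Z ?_ ?_
      · rw [map_mul, map_pow, ← hY]; ring
      · rw [← hZ]; ring
  refine key m ⟨D * Y, ?_⟩
  rw [hm, map_mul, ← hY]; ring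
end
end M11

namespace M11
open NumberField Matrix

theorem lz_lift {p : ℕ} (l : List ℤ) (h : lzero p l = true) :
    ∃ B : ℤ[X], ev (X : ℤ[X]) l = (p : ℤ[X]) * B := by
  apply dvd_lift
  have h1 := map_ev (X : ℤ[X]) (mapRingHom (Int.castRingHom (ZMod p))) l
  rw [coe_mapRingHom] at h1
  rw [h1, map_X, ev_zero _ p (by simp) l h]

def lgp (t G : List ℤ) : ℕ → List ℤ
  | 0 => [1]
  | k + 1 => lrem 12 t (lmul G (lgp t G k))

theorem ev_gp {R : Type*} [CommRing R] (x : R) (t G : List ℤ) (ht : t.length ≤ 12)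
    (hx : x ^ 12 + ev x t = 0) (k : ℕ) : ev x (lgp t G k) = ev x G ^ k := by
  induction k with
  | zero => simp [lgp, ev]
  | succ k ih => rw [lgp, ev_rem x 12 t ht hx, ev_mul, ih]; ring

/-- data for Dedekind's criterion -/
structure Ded (p : ℕ) (F t G G' H T a b c s r : List ℤ) (m : ℕ) : Prop where
  e1 : lzero 0 (ladd (ladd (lmul G H) (lsc p T)) (lsc (-1) F)) = true
  e2 : lzero p (ladd (ladd (ladd (lmul a G) (lmul b H)) (lmul c T)) [-1]) = true
  e3 : lzero p (ladd (ladd (lmul s G) (lmul r G')) [-1]) = true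
  e4 : lzero p (lgp t G m) = true
  e5 : m ≠ 0

theorem dvd_of_root {K : Type} [Field K] [NumberField K] {F t : List ℤ} (hF : F = t ++ [1])
    (hirr : Irreducible (ev (X : ℤ[X]) F)) (x : 𝓞 K) (hx : ev x F = 0) :
    ∀ P : ℤ[X], aeval x P = 0 → ev (X : ℤ[X]) F ∣ P := by
  obtain ⟨hmon, hdeg⟩ := ev_list_monic (R := ℤ) F t hF
  have hxK : ev (x : K) F = 0 := by
    have := congrArg (algebraMap (𝓞 K) K) hx
    rwa [map_ev, map_zero] at this
  have hmin := ev_minpoly F t hF hirr (x : K) hxK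
  intro P hP
  have h1 : aeval (x : K) (P.map (algebraMap ℤ ℚ)) = 0 := by
    rw [aeval_map_algebraMap]
    have := congrArg (algebraMap (𝓞 K) K) hP
    rwa [← aeval_algebraMap_apply, map_zero] at this
  have h2 := minpoly.dvd ℚ (x : K) h1
  rw [hmin] at h2
  have h3 : (ev (X : ℤ[X]) F).map (algebraMap ℤ ℚ) = ev (X : ℚ[X]) F := by
    have := map_ev (X : ℤ[X]) (mapRingHom (algebraMap ℤ ℚ)) F
    simpa using this
  rw [← h3] at h2
  exact (Polynomial.map_dvd_map (algebraMap ℤ ℚ) (RingHom.injective_int _) hmon).1 h2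

theorem ded_ndvd {K : Type} [Field K] [NumberField K] {p : ℕ} [hp : Fact p.Prime]
    {F t G H T a b c s r l : List ℤ} {g0 : ℤ} {m : ℕ} (hG : G = g0 :: l)
    (D : Ded p F t G (lder 1 l) H T a b c s r m) (hF : F = t ++ [1]) (ht : t.length = 12)
    (hirr : Irreducible (ev (X : ℤ[X]) F)) (x : 𝓞 K) (hx : ev x F = 0)
    (A : Matrix (Fin 12) (Fin 12) ℤ)
    (hA : ∀ v : Fin 12 → ℤ, ∀ p : ℤ, (∃ z : 𝓞 K, p * z = ∑ j, (v j : 𝓞 K) * x ^ (j : ℕ)) ↔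
        ∃ w : Fin 12 → ℤ, A *ᵥ v = p • w) : ¬ (p : ℤ) ∣ A.det := by
  intro hdvd
  obtain ⟨v, ⟨i, hi⟩, hw⟩ := (det_dvd A p).1 hdvd
  obtain ⟨z, hz⟩ := (hA v p).2 hw
  obtain ⟨hmon, hdeg⟩ := ev_list_monic (R := ℤ) F t hF
  have hx' : x ^ 12 + ev x t = 0 := by
    rw [hF, ev_append, ht] at hx; simp [ev] at hx; linear_combination hx
  have hdiv := dvd_of_root hF hirr x hx
  let Y : ℤ[X] := ∑ j : Fin 12, C (v j) * X ^ (j : ℕ)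
  have hY : aeval x Y = p * z := by
    have h := hz
    push_cast at h
    rw [h]; simp [Y]
  have hF0 : aeval x (ev (X : ℤ[X]) F) = 0 := by rw [aeval_ev, hx]
  have e1 := ev_zero (X : ℤ[X]) 0 (by simp) _ D.e1
  simp only [ev_add, ev_mul, ev_sc] at e1
  obtain ⟨d, e2⟩ := lz_lift _ D.e2
  simp only [ev_add, ev_mul, ev_sc] at e2
  obtain ⟨dd, e4⟩ := lz_lift _ D.e4
  have e4' := congrArg (aeval x) e4
  rw [aeval_ev, ev_gp x t G ht.le hx', map_mul] at e4'
  have hsep : ((ev (X : ℤ[X]) G).map (Int.castRingHom (ZMod p))).Separable := by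
    have h1 := map_ev (X : ℤ[X]) (mapRingHom (Int.castRingHom (ZMod p))) G
    rw [coe_mapRingHom, map_X] at h1
    have h2 := ev_zero (X : (ZMod p)[X]) p (by simp) _ D.e3
    simp only [ev_add, ev_mul, ev_sc] at h2
    have h3 : derivative (ev (X : (ZMod p)[X]) G) = ev X (lder 1 l) := by
      have hq : derivative (ev (X : ℚ[X]) G) = ev X (lder 1 l) := by
        rw [ev_lder, hG]; simp [ev]
      have hz : derivative (ev (X : ℤ[X]) G) = ev X (lder 1 l) := by
        apply Polynomial.map_injective (Int.castRingHom ℚ) (RingHom.injective_int _)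
        have h4 := map_ev (X : ℤ[X]) (mapRingHom (Int.castRingHom ℚ))
        simp only [coe_mapRingHom, map_X] at h4
        rw [← derivative_map, h4, h4, hq]
      have h4 := map_ev (X : ℤ[X]) (mapRingHom (Int.castRingHom (ZMod p)))
      simp only [coe_mapRingHom, map_X] at h4
      rw [← h4, derivative_map, hz, h4]
    rw [h1]
    refine ⟨ev X s, ev X r, ?_⟩
    rw [h3]
    simp [ev] at h2
    linear_combination h2
  obtain ⟨Z, hZ⟩ := dedekind x (ev (X : ℤ[X]) F) hdiv hF0 (p := p) (ev X G) (ev X H) (ev X T)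
    (by push_cast at e1; linear_combination -e1) hsep (ev X a) (ev X b) (ev X c) (-d) 0
    (by simp [ev] at e2; linear_combination e2) m D.e5 dd (by simpa [aeval_ev] using e4') z Y hY.symm
  let R := Z %ₘ ev (X : ℤ[X]) F
  have hR : aeval x R = z := by
    rw [hZ]
    conv_rhs => rw [← modByMonic_add_div Z (ev (X : ℤ[X]) F)]
    rw [map_add, map_mul, hF0]; simp [R]
  have hmon0 : (12 : WithBot ℕ) = (ev (X : ℤ[X]) F).degree := by
    rw [degree_eq_natDegree hmon.ne_zero, hdeg, ht]; rfl
  have hRd : R.degree < 12 := by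
    rw [hmon0]; exact degree_modByMonic_lt _ hmon
  have hYd : Y.degree < 12 := degree_sum_fin_lt v
  have h0 : Y - C (p : ℤ) * R = 0 := by
    by_contra hne
    have h1 := hdiv (Y - C (p : ℤ) * R) (by rw [map_sub, map_mul, hY, hR]; simp)
    have h2 := degree_le_of_dvd h1 hne
    rw [← hmon0] at h2
    refine absurd h2 (not_le.2 ((degree_sub_le _ _).trans_lt (max_lt hYd ?_)))
    rwa [degree_C_mul (by exact_mod_cast hp.out.ne_zero)]
  have h1 := congrArg (fun q => coeff q (i : ℕ)) h0
  simp only [coeff_sub, coeff_C_mul, coeff_zero] at h1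
  have h2 : coeff Y (i : ℕ) = v i := by
    simp only [Y, finsetSum_coeff, coeff_C_mul, coeff_X_pow]
    rw [Finset.sum_eq_single i]
    · simp
    · intro j _ hj
      rw [if_neg (by intro h; exact hj (Fin.ext h.symm)), mul_zero]
    · simp
  exact hi ⟨R.coeff i, by linear_combination h1 - h2⟩

def tT : List ℤ := [-3673,-1623,37836,-49905,25320,-7149,2826,-1197,270,-55,12,-3]

theorem ded3 : Ded 3 FT tT [-1, 0, 0, -1, 1] (lder 1 [0, 0, -1, 1]) [1, 0, 0, -1, 1, 0, 1, 1, 1]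
    [-1224, -541, 12612, -16635, 8440, -2383, 942, -398, 90, -18, 4, -1]
    [-1, 0, 0, -1, 1, 0, 0, 0, 0, -1, 1] [] [0, 0, -1, 1] [-1] [-1, 1] 3 :=
  ⟨by decide +kernel, by decide +kernel, by decide +kernel, by decide +kernel, by decide⟩

theorem ded5 : Ded 5 FT tT [2, 2, 1] (lder 1 [2, 1]) [1, 0, 0, 0, 0, -2, 0, 0, 0, 0, 1]
    [-735, -325, 7567, -9981, 5064, -1429, 566, -239, 54, -11, 2, -1]
    [1, 2, 2, 0, 1, -2, -1, -1, 0, 0, -2, -1, 0, 2, -2, -2, -2, -1, 2]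
    [-1, -1, 0, 2, -1, 2, 0, -2, 0, 2, -2] [-2] [1] [2, 2] 11 :=
  ⟨by decide +kernel, by decide +kernel, by decide +kernel, by decide +kernel, by decide⟩

theorem ded7 : Ded 7 FT tT [-2, 2, -2, -2, 0, 1, -3, -2, 1] (lder 1 [2, -2, -2, 0, 1, -3, -2, 1])
    [-1, 2, -1, -1, 1] [-525, -231, 5404, -7129, 3618, -1022, 403, -170, 39, -9, 2] []
    [-1, -2, -3, 0, -3, 0, 1, -2, 2, -2] [-1, -2, -1, 1] [2, -1, 2, -1, 0, -3, 1]
    [-1, 2, -1, 2, 2, 0, -2, -1] 2 :=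
  ⟨by decide +kernel, by decide +kernel, by decide +kernel, by decide +kernel, by decide⟩

end M11

namespace M11
open NumberField Matrix

def g5 : List ℤ := [1, 5, 15, 30, 45, 51, 45, 30, 15, 5, 1]
def vT : List ℤ := [1, 6, 20, 45, 75, 96, 96, 75, 45, 20, 6, 1]
def T0 : List ℤ := [-1837, -815, 18905, -24985, 12600, -3660, 1317, -684, 75, -60, -7, -5]
def T1 : List ℤ := [-63099, 62284, -43379, 18394, -5794, 2134, -817, 133, -58, -2, -5]

theorem leq {R : Type*} [CommRing R] (x : R) (a b : List ℤ)
    (h : lzero 0 (ladd a (lsc (-1) b)) = true) : ev x a = ev x b := by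
  have := ev_zero x 0 (by simp) _ h
  rw [ev_add, ev_sc] at this
  push_cast at this
  linear_combination this

section
variable {R : Type*} [CommRing R] (x : R)
theorem ev_g : ev x [1, 1, 1] = x ^ 2 + x + 1 := by simp [ev]; ring
theorem ev_g5 : ev x g5 = (x ^ 2 + x + 1) ^ 5 := by
  simp [ev, g5]; ring
theorem ev_vT : ev x vT = ev x g5 * (x + 1) := by
  rw [leq x vT (lmul g5 [1, 1]) (by decide +kernel), ev_mul]; simp [ev]; ring
theorem ev_FT : ev x FT = ev x g5 * (x + 1) ^ 2 + 2 * ev x T0 := by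
  rw [leq x FT (ladd (lmul g5 [1, 2, 1]) (lsc 2 T0)) (by decide +kernel), ev_add, ev_mul, ev_sc]
  simp [ev]; ring
theorem ev_T0 : ev x T0 = ev x T1 * (x + 1) + 61262 := by
  rw [leq x T0 (ladd (lmul T1 [1, 1]) [61262]) (by decide +kernel), ev_add, ev_mul]
  simp [ev]; ring
end

theorem two_dvd {K : Type} [Field K] [NumberField K] (x : 𝓞 K) (hx : ev x FT = 0)
    (A : Matrix (Fin 12) (Fin 12) ℤ)
    (hA : ∀ v : Fin 12 → ℤ, ∀ p : ℤ, (∃ z : 𝓞 K, p * z = ∑ j, (v j : 𝓞 K) * x ^ (j : ℕ)) ↔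
        ∃ w : Fin 12 → ℤ, A *ᵥ v = p • w) : (2 : ℤ) ∣ A.det := by
  refine (det_dvd A 2).2 ⟨fun j => lco vT j, ⟨0, by decide⟩, (hA _ _).1 ?_⟩
  rw [← ev_sum x 12 vT (by decide)]
  have e1 := ev_FT x
  rw [hx] at e1
  have e2 := ev_vT x
  have e3 := ev_T0 x
  let α : K := (ev x vT : 𝓞 K) / 2
  have hα : α ^ 2 + (ev x T1 : 𝓞 K) * α + (30631 * ev x g5 : 𝓞 K) = 0 := by
    have h : ((ev x vT) ^ 2 + 2 * ev x T1 * ev x vT + 4 * (30631 * ev x g5) : 𝓞 K) = 0 := by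
      rw [e2]; rw [e3] at e1
      linear_combination -(ev x g5) * e1
    have h2 := congrArg (algebraMap (𝓞 K) K) h
    simp only [map_add, map_mul, map_pow, map_ofNat, map_zero] at h2
    simp only [α, map_mul, map_ofNat]
    linear_combination h2 / 4
  have hint : IsIntegral (𝓞 K) α := by
    refine ⟨X ^ 2 + (C (ev x T1) * X + C (30631 * ev x g5)), ?_, ?_⟩
    · apply monic_X_pow_add
      exact (degree_linear_le).trans_lt (by norm_num)
    · simp only [eval₂_add, eval₂_pow, eval₂_X, eval₂_mul, eval₂_C]
      linear_combination hα
  have hint2 : IsIntegral ℤ α := isIntegral_trans (A := 𝓞 K) α hint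
  obtain ⟨z, hz⟩ : ∃ z : 𝓞 K, algebraMap (𝓞 K) K z = α := IsIntegralClosure.isIntegral_iff.1 hint2
  refine ⟨z, ?_⟩
  apply FaithfulSMul.algebraMap_injective (𝓞 K) K
  rw [map_mul, hz, map_intCast]
  simp only [α]
  push_cast
  ring

theorem exists_P {K : Type} [Field K] [NumberField K] (x : 𝓞 K)
    (hdiv : ∀ P : ℤ[X], aeval x P = 0 → ev (X : ℤ[X]) FT ∣ P)
    (k : Type) [Field k] [IsAlgClosed k] [CharP k 2] :
    ∃ P : Ideal (𝓞 K), P.IsPrime ∧ 2 ∈ P ∧ x ^ 2 + x + 1 ∈ P ∧ ev x T0 ∉ P := by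
  have h2 : (2 : k) = 0 := by exact_mod_cast CharP.cast_eq_zero k 2
  obtain ⟨w, hw⟩ : ∃ w : k, w ^ 2 + w + 1 = 0 := by
    obtain ⟨w, hw⟩ := IsAlgClosed.exists_root (X ^ 2 + (C 1 * X + C 1) : k[X]) (by
      rw [degree_add_eq_left_of_degree_lt]
      · simp
      · rw [degree_X_pow]; exact (degree_linear_le).trans_lt (by norm_num))
    refine ⟨w, ?_⟩
    simp [IsRoot] at hw
    linear_combination hw
  have hw0 : w ≠ 0 := by rintro rfl; simp at hw
  let φ : ℤ[X] →+* k := (aeval w).toRingHom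
  have hφ : ∀ l, φ (ev X l) = ev w l := fun l => aeval_ev w l
  let _ : Algebra ℤ[X] (𝓞 K) := (aeval x).toRingHom.toAlgebra
  have hal : ∀ q, algebraMap ℤ[X] (𝓞 K) q = aeval x q := fun q => rfl
  have : Algebra.IsIntegral ℤ[X] (𝓞 K) := by
    constructor
    intro y
    obtain ⟨q, hq, hqy⟩ := Algebra.IsIntegral.isIntegral (R := ℤ) y
    refine ⟨q.map C, hq.map _, ?_⟩
    rw [eval₂_map]
    have : (algebraMap ℤ[X] (𝓞 K)).comp C = algebraMap ℤ (𝓞 K) := RingHom.ext_int _ _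
    rwa [this]
  have hpr : (RingHom.ker φ).IsPrime := RingHom.ker_isPrime φ
  obtain ⟨Q, hQ, hQc⟩ := Ideal.exists_ideal_over_prime_of_isIntegral_of_isDomain (S := 𝓞 K)
    (RingHom.ker φ) (by
      intro q hq
      obtain ⟨r, rfl⟩ := hdiv q hq
      rw [RingHom.mem_ker, map_mul, hφ, ev_FT, ev_g5, hw, h2]; ring)
  have hmem : ∀ l, ev x l ∈ Q ↔ ev w l = 0 := by
    intro l
    rw [← hφ, ← RingHom.mem_ker, ← hQc, Ideal.mem_comap, hal, aeval_ev]
  refine ⟨Q, hQ, ?_, ?_, ?_⟩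
  · have := (hmem [2]).2 (by simp [ev, h2])
    simpa [ev] using this
  · have := (hmem [1, 1, 1]).2 (by rw [ev_g, hw])
    rwa [ev_g] at this
  · rw [hmem]
    have h := ev_zero w 2 (by exact_mod_cast h2) (ladd T0 (lsc (-1)
      (ladd [0, 1] (lmul [1, 1, 1] [1, 1, 1, 1, 0, 1, 0, 1, 0, 1])))) (by decide +kernel)
    rw [ev_add, ev_sc, ev_add, ev_mul, ev_g, hw, zero_mul] at h
    intro h0
    rw [h0] at h
    simp [ev] at h
    exact hw0 h

theorem disc_two {K : Type} [Field K] [NumberField K] (x : 𝓞 K) (hx : ev x FT = 0)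
    (hdiv : ∀ P : ℤ[X], aeval x P = 0 → ev (X : ℤ[X]) FT ∣ P) : (2 : ℤ) ^ 8 ∣ discr K := by
  obtain ⟨P, hP, h2, hg, hT⟩ := exists_P x hdiv (AlgebraicClosure (ZMod 2))
  have hP0 : P ≠ ⊥ := by
    rintro rfl
    rw [Ideal.mem_bot] at h2
    exact two_ne_zero h2
  have hmax : P.IsMaximal := hP.isMaximal hP0
  have e1 := ev_FT x
  rw [hx, ev_g5] at e1
  have hmem : -(2 * ev x T0) ∈ P ^ 5 := by
    have : -(2 * ev x T0) = (x ^ 2 + x + 1) ^ 5 * (x + 1) ^ 2 := by linear_combination e1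
    rw [this]
    exact Ideal.mul_mem_right _ _ (Ideal.pow_mem_pow hg 5)
  have h5 : (2 : 𝓞 K) ∈ P ^ 5 := by
    have h1 : IsCoprime (Ideal.span {ev x T0}) (P ^ 5) := by
      apply IsCoprime.pow_right
      rw [Ideal.isCoprime_iff_sup_eq, sup_comm]
      exact hmax.out.2 _ (left_lt_sup.2 (by rwa [Ideal.span_singleton_le_iff_mem]))
    rw [Ideal.isCoprime_iff_exists] at h1
    obtain ⟨a, ha, b, hb, hab⟩ := h1
    obtain ⟨c, rfl⟩ := Ideal.mem_span_singleton'.1 ha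
    have : (2 : 𝓞 K) = (-c) * (-(2 * ev x T0)) + 2 * b := by linear_combination -2 * hab
    rw [this]
    exact Ideal.add_mem _ (Ideal.mul_mem_left _ _ hmem) (Ideal.mul_mem_left _ _ hb)
  have h4 : 4 ∣ Ideal.absNorm P := by
    have h20 : (2 : 𝓞 K ⧸ P) = 0 := by
      have := Ideal.Quotient.eq_zero_iff_mem.2 h2
      rwa [map_ofNat] at this
    let _ := Ideal.Quotient.field P
    have hfin : Finite (𝓞 K ⧸ P) := Ideal.finiteQuotientOfFreeOfNeBot P hP0
    let _ := Fintype.ofFinite (𝓞 K ⧸ P)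
    have hchar : CharP (𝓞 K ⧸ P) 2 := CharTwo.of_one_ne_zero_of_two_eq_zero one_ne_zero h20
    obtain ⟨n, -, hn⟩ := FiniteField.card (𝓞 K ⧸ P) 2
    have hcard : Ideal.absNorm P = 2 ^ (n : ℕ) := by
      rw [← hn, Ideal.absNorm_apply, Submodule.cardQuot_apply, Nat.card_eq_fintype_card]
    have hn1 : (n : ℕ) ≠ 1 := by
      intro h
      have h1 := FiniteField.pow_card (Ideal.Quotient.mk P x)
      rw [hn, h, pow_one] at h1
      have h3 := Ideal.Quotient.eq_zero_iff_mem.2 hg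
      rw [map_add, map_add, map_pow, h1, map_one] at h3
      have : (1 : 𝓞 K ⧸ P) = 0 := by linear_combination h3 - (Ideal.Quotient.mk P x) * h20
      exact one_ne_zero this
    rw [hcard]
    have := n.pos
    exact pow_dvd_pow 2 (show 2 ≤ (n : ℕ) by omega)
  have hd : P ^ (5 - 1) ∣ differentIdeal ℤ (𝓞 K) := by
    have hm : (Ideal.span {(2 : ℤ)}).IsMaximal :=
      PrincipalIdealRing.isMaximal_of_irreducible Int.prime_two.irreducible
    refine pow_sub_one_dvd_differentIdeal ℤ (p := Ideal.span {(2 : ℤ)}) P 5 (by simp) ?_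
    rw [Ideal.map_span, Set.image_singleton, Ideal.dvd_span_singleton]
    simpa using h5
  have := Ideal.absNorm_dvd_absNorm_of_le (Ideal.dvd_iff_le.mp hd)
  rw [absNorm_differentIdeal K, map_pow] at this
  have h6 : 4 ^ 4 ∣ (discr K).natAbs := (pow_dvd_pow_of_dvd h4 4).trans this
  rw [← Int.natCast_dvd] at h6
  exact_mod_cast h6
end M11

namespace M11
open NumberField Matrix

def lcomb : List ℤ → List (List ℤ) → List ℤ
  | [], _ => []
  | _ :: _, [] => []
  | c :: l, r :: R => ladd (lsc c r) (lcomb l R)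

theorem lco_add (a b : List ℤ) (j : ℕ) : lco (ladd a b) j = lco a j + lco b j := by
  induction a generalizing b j with
  | nil => simp [ladd, lco]
  | cons c l ih =>
    cases b with
    | nil => simp [ladd, lco]
    | cons d m =>
      cases j with
      | zero => simp [ladd, lco]
      | succ j => simpa [ladd, lco] using ih m j

theorem lco_sc (c : ℤ) (a : List ℤ) (j : ℕ) : lco (lsc c a) j = c * lco a j := by
  induction a generalizing j with
  | nil => simp [lsc, lco]
  | cons d l ih =>
    cases j with
    | zero => simp [lsc, lco]
    | succ j => simpa [lsc, lco] using ih j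

theorem lco_comb (n : ℕ) (c : List ℤ) (R : List (List ℤ)) (h : R.length = n) (j : ℕ) :
    lco (lcomb c R) j = ∑ k : Fin n, lco c k * lco (R.getD k []) j := by
  induction n generalizing c R with
  | zero =>
    have : R = [] := List.length_eq_zero_iff.1 h
    subst this
    cases c <;> simp [lcomb, lco]
  | succ n ih =>
    cases R with
    | nil => simp at h
    | cons r R =>
      cases c with
      | nil => simp [lcomb, lco]
      | cons c l =>
        rw [lcomb, lco_add, lco_sc, ih l R (by simpa using h), Fin.sum_univ_succ]
        rfl

def lmat (R : List (List ℤ)) : Matrix (Fin 12) (Fin 12) ℤ := fun i j => lco (R.getD i []) j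

theorem det_cert (R L U : List (List ℤ)) (N : ℤ) (hR : R.length = 12) (hL : L.length = 12)
    (h : L.map (fun c => lcomb c R) = U)
    (h1 : ∀ i j : Fin 12, i < j → lco (L.getD i []) j = 0)
    (h2 : ∀ i j : Fin 12, j < i → lco (U.getD i []) j = 0)
    (h3 : (∏ i : Fin 12, lco (L.getD i []) i) ≠ 0)
    (h4 : (∏ i : Fin 12, lco (L.getD i []) i) * N = ∏ i : Fin 12, lco (U.getD i []) i) :
    (lmat R).det = N := by
  have hmul : lmat L * lmat R = lmat U := by
    ext i j
    rw [Matrix.mul_apply]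
    simp only [lmat]
    rw [← h, ← lco_comb 12 _ R hR]
    congr 1
    have hi : (i : ℕ) < L.length := by rw [hL]; exact i.2
    rw [List.getD_eq_getElem _ _ hi, List.getD_eq_getElem _ _ (by simpa using hi), List.getElem_map]
  have hdL : (lmat L).det = ∏ i : Fin 12, lco (L.getD i []) i :=
    Matrix.det_of_lowerTriangular _ (fun i j hij => h1 i j hij)
  have hdU : (lmat U).det = ∏ i : Fin 12, lco (U.getD i []) i :=
    Matrix.det_of_upperTriangular (fun i j hij => h2 i j hij)
  have hd := congrArg Matrix.det hmul
  rw [Matrix.det_mul, hdL, hdU, ← h4] at hd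
  exact mul_left_cancel₀ h3 hd

def lrows (t : List ℤ) : ℕ → List ℤ → List (List ℤ)
  | 0, _ => []
  | n + 1, y => y :: lrows t n (lrem 12 t (0 :: y))

theorem lrow_succ (t y : List ℤ) (k : ℕ) :
    lrow t (lrem 12 t (0 :: y)) k = lrow t y (k + 1) := by
  induction k with
  | zero => rfl
  | succ k ih => rw [lrow, ih]; rfl

theorem lrows_getD (t : List ℤ) (n : ℕ) (y : List ℤ) (i : ℕ) (hi : i < n) :
    (lrows t n y).getD i [] = lrow t y i := by
  induction n generalizing y i with
  | zero => omega
  | succ n ih =>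
    cases i with
    | zero => rfl
    | succ i => rw [lrows, List.getD_cons_succ, ih _ _ (by omega), lrow_succ]

theorem lrows_mat (t y : List ℤ) (R : List (List ℤ)) (h : lrows t 12 y = R) :
    (Matrix.of fun i j : Fin 12 => lco (lrow t y i) j) = lmat R := by
  ext i j
  rw [← h, lmat, lrows_getD _ _ _ _ i.2]; rfl

def R0 : List (List ℤ) := [[-96,318,-345,780,-2730,6186,-8883,7560,-3690,690,231,12],
  [-192,1056,-1590,1035,-1560,3822,-6186,6345,-3780,1230,-138,-21],
  [336,-2208,4395,-4005,5130,-13026,25473,-32835,26190,-12390,2679,303],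
  [-4848,29424,-50385,39240,-63090,170568,-325419,409980,-319170,150420,-33297,-3684],
  [58944,-358512,615180,-474045,757620,-2074554,3968772,-5000415,3891360,-1829610,404616,44067],
  [-705072,4289376,-7365165,5682885,-9067110,24818202,-47507631,59889795,-46643730,21958830,-4870233,-520791],
  [8332656,-50701008,87095145,-67256130,107237130,-293418996,561753723,-708391410,552037290,-260168040,57893409,6066378],
  [-97062048,590704944,-1015255110,784728615,-1250199840,3419479518,-6547854714,8259987405,-6441118620,3039252270,-678748122,-69500529],
  [1112008464,-6769112832,11641289055,-9007815945,14337331770,-39197488674,75074524917,-94744026015,73937987310,-34936335510,7834788771,780762987],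
  [-12492207792,76065255216,-130910427765,101429032560,-161256598410,440633922672,-844164128271,1065862755420,-832565048730,394050811980,-88808981613,-8561233956],
  [136979743296,-834370667568,1437301454220,-1115452332705,1770869653980,-4835690338386,9267266131308,-11708370018435,9156228843840,-4342670970690,984775954944,90976931463],
  [-1455630903408,8870765163744,-15299702770185,11899648572465,-18855953967990,51444274232778,-98632906676739,124716992157855,-97681570250970,46456770743670,-10620079241637,-925739605779]]
def L0 : List (List ℤ) := [[1],
  [-2,1],
  [-48,73,28],
  [680,-2892,807,157],
  [-56528,188384,-61459,64915,6211],
  [100416,-717040,1013020,-490997,983357,86249],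
  [4870496,-8149056,-43193574,13606142,13595355,10574235,808099],
  [-203285984,467287968,1088929278,41891140,-916429206,555332067,122078903,5890737],
  [1027894240,-3302540448,-2442783294,-248043044,9158221140,-9522927432,9028383479,1641110961,69067899],
  [955875040,1262634336,-16001681262,-11162377172,7478238900,28822762974,-30368013538,37599729783,6638432037,276941175],
  [5943796304,-21615722720,-706974485,-12431607215,43221348720,-84303878909,119976124815,-61862408630,28519843085,5990720695,263226931],
  [-28118048,134997424,-117597630,61197255,-269320745,636685178,-1048703189,973164065,-494481490,127947835,32025573,1466701]]
def U0 : List (List ℤ) := [[-96,318,-345,780,-2730,6186,-8883,7560,-3690,690,231,12],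
  [0,420,-900,-525,3900,-8550,11580,-8775,3600,-150,-600,-45],
  [0,0,23550,-74025,160800,-382650,688050,-819075,634500,-290250,53850,6375],
  [0,0,0,465825,-3110100,9420450,-18684600,24660075,-20551800,10529250,-2509500,-264975],
  [0,0,0,0,155248200,-641746800,1296718200,-1657774800,1337202000,-645008400,147891600,11296800],
  [0,0,0,0,0,1454578200,-5637913200,9889900200,-10796590800,7547569200,-2985994800,547930800],
  [0,0,0,0,0,0,31809979800,-162418381200,322359604200,-342760107600,219006190800,-68609019600],
  [0,0,0,0,0,0,0,1864833273000,-5611507081200,6801301150200,-4750345126800,1734571530000],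
  [0,0,0,0,0,0,0,0,2093675283000,-4627982444400,2160415643400,451650956400],
  [0,0,0,0,0,0,0,0,0,9949977991800,-23648659246800,14042218768200],
  [0,0,0,0,0,0,0,0,0,0,-831619467000,996433326000],
  [0,0,0,0,0,0,0,0,0,0,0,2835000]]
def RT : List (List ℤ) := [[-1623,75672,-149715,101280,-35745,16956,-8379,2160,-495,120,-33,12],
  [44076,17853,-378360,449145,-202560,50043,-16956,5985,-1080,165,-24,3],
  [11019,48945,-95655,-228645,373185,-181113,41565,-13365,5175,-915,129,-15],
  [-55095,-13326,616485,-844230,151155,265950,-138723,23610,-9315,4350,-735,84],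
  [308532,81237,-3191550,4808505,-2971110,751671,28566,-38175,930,-4695,3342,-483],
  [-1774059,-475377,18356025,-27295665,17038065,-6424077,2116629,-549585,92235,-25635,1101,1893],
  [6952989,1298280,-72098925,112826190,-75226425,30571122,-11773695,4382550,-1060695,196350,-48351,6780],
  [24902940,17956929,-255229800,266256975,-58843410,-26756205,11410842,-3658035,2551950,-687795,114990,-28011],
  [-102884403,-20558913,1077781125,-1653118755,975495495,-259094049,52402881,-22118325,3904935,1011345,-351663,30957],
  [113705061,-52641192,-1191847965,2622690210,-2436949995,1196807088,-346578531,89458410,-30476715,5607570,639861,-258792],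
  [-950543016,-306314355,9739012920,-14106862725,9175303650,-4287054003,1928153280,-656352555,159332250,-44710275,8713074,-136515],
  [-501419595,-1172106861,4858867185,2926231845,-10650302925,8199357915,-3901262613,1764744825,-619493505,151823925,-43072095,8303529]]
def LT : List (List ℤ) := [[1],
  [14692,541],
  [-217841957,-101474167,373810499],
  [1043827846177,2014400358674,-2028666420032,1175037704551],
  [-18083684772417281,-72253220605225282,38653876207522516,40493807703161197,16077302855085540],
  [-8333881175126566267,-27056337383996021624,18153805583993772944,7630461412478624285,33502805919038686860,5037777768739700022],
  [-62461985375608349362241567,-133292347591181870648895040,446132404592733222751465192,-89586128031057648030323927,38208650189089974306308748,111467956419650153713504542,26159120495923939384073352],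
  [43408280277500892570896395697051,67978152641477654594506052820388,-386787803419295147763532683668452,130663441570821259464643121278871,-10939001624330456368275538147488,11552324279987624645761546971330,218489810302535897803905783296,1240236830014010247555597331084],
  [1395195744579956978522707294967829737,3107304151159749089756026445844735996,-10964180652383992696393757152333165080,-3947256533856708557669884057330744271,2360679097427819738554349543495137604,124191148124748249819711294296291298,168886244346371660198238948374927960,27223820567554396271868103711844684,25189366320082983985245998814245372],
  [676955900653106259315695535228618101003,2808728970811186271219865262983224240292,-2022992460755145187087838619332720442696,-11504293815540031158178324713033921621101,-6061834290426824703783095688737892538324,3435629690025283588167101815433454158838,90793371828923891457055115289781752248,240760723298629530241434924277028252612,32138123974973733037332016280892674516,34392660969251590493685754502123254992],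
  [-6438790388938747931563660910438179798338419,-8361267050228400560271041799465464092220604,60473959813095146171031967620402751660489456,-33908019026752260727484812671279211135056571,3105063738521084345318820459366234263656228,-3596623932380447177728974554596396914351670,1694393114962734754377728237626952152380608,-65865964189057653187041957512005433755004,114756273875571650107421519764278188461340,9694784342071507770066323712764458121728,9417389961189175341561964187079346862488],
  [26965417586252125314275994017706488015683813995,24123834067845978871188154224951966658227480101,-266851256370525160007100518049373516675325219451,245563144938913865786302063153083706793445692168,-74715097977409588075900978246665007725698295107,18660984293127133992803549872008560502832101512,-12298628973429754758663193522219063785571998524,3219922628169882841695284182221051449645573611,-524566876685966168732601623412012360546841531,166289706676129028911455042679755978259275622,-12822831027132497496183042700555954555661566,16217530823715982000207342633977212594476355]]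
def UT : List (List ℤ) := [[-1623,75672,-149715,101280,-35745,16956,-8379,2160,-495,120,-33,12],
  [0,1121431497,-2404305540,1730993205,-634750500,276190815,-132277464,34972605,-7856820,1852305,-497820,177927],
  [0,0,35251131136530,-153109549686030,167841839089800,-76473740867460,19083327124290,-6073838835750,2151893201400,-384920878980,57845718960,-8525683470],
  [0,0,0,482319085652566200,-1024803616742837820,798424920965494260,-290228681241851880,69166621202583000,-24136072112783700,7425279189848580,-1208142608561130,147702298712910],
  [0,0,0,0,-11939533311913089052140,11931056113719301635420,-2174861084791299539160,-645797576565487694400,-75229215509798118900,51205006301689249260,31284586402657976490,-5377429454138296230],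
  [0,0,0,0,0,-9933843226300230145850640,11844786952377852663845640,-4290060491255055936055440,552031353400744953735480,-275321693265975662995680,115170792662968190276430,-6457865854036642626030],
  [0,0,0,0,0,0,-37207104900420307426667919932520,42913560820609832927365579830960,-14111962914845658308743309565160,1272073151184086699918957756400,-885742959993571482327323757210,354546258732650905833621527610],
  [0,0,0,0,0,0,0,-755680989602489519557379964427361160,674966342952225141533620233057140040,-116191236756963060837317721471606000,-40785607239068578209208033359158790,11395554679389792909251625060995070],
  [0,0,0,0,0,0,0,0,-21667376410628502011022025336337650644960,19186305695477414406601101039683407261680,-4501158314830383949239187384631218544130,116112773594189203204162316143215192930],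
  [0,0,0,0,0,0,0,0,0,-29664778377745902325920187189299942616837200,25628777576919091935984417853576834570130010,-5521968343358849982146891333482239685479450],
  [0,0,0,0,0,0,0,0,0,0,-2043408883788213732026125171881128786904020730,925032021744559703130622174307382926756373690],
  [0,0,0,0,0,0,0,0,0,0,0,491655215674575497674345786737500558099126070]]

def t0 : List ℤ := [16,-96,159,-115,195,-546,1031,-1269,945,-410,69,21]

theorem det0 : (Matrix.of fun i j : Fin 12 => lco (lrow t0 (lder 1
    [-96,159,-115,195,-546,1031,-1269,945,-410,69,21,1]) i) j).det =
    2 ^ 30 * 3 ^ 28 * 5 ^ 24 * 7 ^ 4 := by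
  rw [lrows_mat t0 _ R0 (by decide +kernel)]
  exact det_cert R0 L0 U0 _ rfl rfl (by decide +kernel) (by decide +kernel) (by decide +kernel)
    (by decide +kernel) (by decide +kernel)

theorem detT : (Matrix.of fun i j : Fin 12 => lco (lrow tT (lder 1
    [-1623,37836,-49905,25320,-7149,2826,-1197,270,-55,12,-3,1]) i) j).det =
    806589077754114381882837021683404173256690889526327690000000000 := by
  rw [lrows_mat tT _ RT (by decide +kernel)]
  exact det_cert RT LT UT _ rfl rfl (by decide +kernel) (by decide +kernel) (by decide +kernel)
    (by decide +kernel) (by decide +kernel)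

end M11

namespace M11
open NumberField Matrix

/-- Horner scheme for `q ^ |F| * F (N / q)` -/
def lhorn (t N : List ℤ) (q : ℤ) : List ℤ → List ℤ
  | [] => []
  | c :: l => ladd [c * q ^ (l.length + 1)] (lrem 12 t (lmul N (lhorn t N q l)))

theorem ev_horn {R : Type*} [CommRing R] (x y : R) (t N : List ℤ) (q : ℤ) (ht : t.length ≤ 12)
    (hx : x ^ 12 + ev x t = 0) (hy : (q : R) * y = ev x N) (F : List ℤ) :
    ev x (lhorn t N q F) = (q : R) ^ F.length * ev y F := by
  induction F with
  | nil => simp [lhorn, ev]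
  | cons c l ih =>
    rw [lhorn, ev_add, ev_rem x 12 t ht hx, ev_mul, ih, ← hy]
    simp only [ev, List.length_cons]
    push_cast; ring

def Nth : List ℤ := [376,-2573,3130,-550,7910,-17851,29178,-29490,15300,-5005,-1156,-52]

theorem ev_integral {K : Type} [Field K] (y : K) {F t : List ℤ} (hF : F = t ++ [1])
    (hy : ev y F = 0) : IsIntegral ℤ y :=
  ⟨ev (X : ℤ[X]) F, (ev_list_monic F t hF).1, by
    have := aeval_ev (A := ℤ) y F
    rw [aeval_def] at this; rw [this, hy]⟩

theorem arith (a b E : ℤ) (h0 : a ^ 2 * E = 2 ^ 30 * 3 ^ 28 * 5 ^ 24 * 7 ^ 4)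
    (hT : b ^ 2 * E = 806589077754114381882837021683404173256690889526327690000000000)
    (h2 : (2 : ℤ) ∣ b) (h3 : ¬ (3 : ℤ) ∣ b) (h5 : ¬ (5 : ℤ) ∣ b) (h7 : ¬ (7 : ℤ) ∣ b)
    (h8 : (2 : ℤ) ^ 8 ∣ E) : E = 2 ^ 8 * 3 ^ 16 * 5 ^ 10 * 7 ^ 4 := by
  have cop : ∀ p : ℤ, Prime p → ¬ p ∣ b → ∀ n : ℕ, p ^ n ∣ b ^ 2 * E → p ^ n ∣ E := by
    intro p hp hb n h
    exact (IsCoprime.pow (hp.coprime_iff_not_dvd.2 hb)).dvd_of_dvd_mul_left h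
  have d3 : (3 : ℤ) ^ 16 ∣ E := cop 3 Int.prime_three h3 16 (by rw [hT]; norm_num)
  have d5 : (5 : ℤ) ^ 10 ∣ E := cop 5 (Int.prime_iff_natAbs_prime.2 (by norm_num)) h5 10
    (by rw [hT]; norm_num)
  have d7 : (7 : ℤ) ^ 4 ∣ E := cop 7 (Int.prime_iff_natAbs_prime.2 (by norm_num)) h7 4
    (by rw [hT]; norm_num)
  have c1 : IsCoprime ((2 : ℤ) ^ 8) (3 ^ 16) := by
    rw [Int.isCoprime_iff_gcd_eq_one]; norm_num
  have c2 : IsCoprime ((2 : ℤ) ^ 8 * 3 ^ 16) (5 ^ 10) := by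
    rw [Int.isCoprime_iff_gcd_eq_one]; norm_num
  have c3 : IsCoprime ((2 : ℤ) ^ 8 * 3 ^ 16 * 5 ^ 10) (7 ^ 4) := by
    rw [Int.isCoprime_iff_gcd_eq_one]; norm_num
  obtain ⟨e, rfl⟩ := c3.mul_dvd (c2.mul_dvd (c1.mul_dvd h8 d3) d5) d7
  obtain ⟨c, rfl⟩ := h2
  have hm : c ^ 2 * e = 883405401978818518033 ^ 2 := by
    have : ((4 : ℤ) * (2 ^ 8 * 3 ^ 16 * 5 ^ 10 * 7 ^ 4)) * (c ^ 2 * e) =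
      (4 * (2 ^ 8 * 3 ^ 16 * 5 ^ 10 * 7 ^ 4)) * 883405401978818518033 ^ 2 := by
      linear_combination hT
    exact mul_left_cancel₀ (by norm_num) this
  have hn : a ^ 2 * e = 2 ^ 22 * 3 ^ 12 * 5 ^ 14 := by
    have : ((2 : ℤ) ^ 8 * 3 ^ 16 * 5 ^ 10 * 7 ^ 4) * (a ^ 2 * e) =
      (2 ^ 8 * 3 ^ 16 * 5 ^ 10 * 7 ^ 4) * (2 ^ 22 * 3 ^ 12 * 5 ^ 14) := by
      linear_combination h0
    exact mul_left_cancel₀ (by norm_num) this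
  have hcop : IsCoprime ((883405401978818518033 : ℤ) ^ 2) (2 ^ 22 * 3 ^ 12 * 5 ^ 14) := by
    rw [Int.isCoprime_iff_gcd_eq_one]; norm_num
  have hu : IsUnit e := hcop.isUnit_of_dvd' ⟨c ^ 2, by rw [← hm]; ring⟩ ⟨a ^ 2, by rw [← hn]; ring⟩
  rcases Int.isUnit_iff.1 hu with rfl | rfl
  · ring
  · nlinarith [sq_nonneg c]

theorem fieldK (K : Type) [Field K] [NumberField K] (e : AdjoinRoot f2 ≃ₐ[ℚ] K) :
    Module.finrank ℚ K = 12 ∧ discr K = 2 ^ 8 * 3 ^ 16 * 5 ^ 10 * 7 ^ 4 := by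
  have hK : Module.finrank ℚ K = 12 := by
    rw [← e.toLinearEquiv.finrank_eq, (AdjoinRoot.powerBasis f2_irr.ne_zero).finrank,
      AdjoinRoot.powerBasis_dim, f2_monic.2]
  refine ⟨hK, ?_⟩
  have hx : aeval (e (AdjoinRoot.root f2)) f2 = 0 := by
    have := aeval_algHom_apply (e : AdjoinRoot f2 →ₐ[ℚ] K) (AdjoinRoot.root f2) f2
    rw [AdjoinRoot.aeval_eq, AdjoinRoot.mk_self, map_zero] at this
    exact this
  generalize e (AdjoinRoot.root f2) = x at hx
  have hβ := (rel_iff x (rel0 x hx)).1 hx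
  generalize x⁻¹ = β at hβ
  let b : 𝓞 K := ⟨β, ev_integral β F0_eq hβ⟩
  let θ : K := ev β Nth / 300
  have hβ' : β ^ 12 + ev β t0 = 0 := by
    rw [F0_eq, ev_append] at hβ
    simp only [List.length_cons, List.length_nil] at hβ
    rw [t0]
    simp only [ev] at hβ ⊢
    linear_combination hβ
  have hθ : ev θ FT = 0 := by
    have h := ev_horn β θ t0 Nth 300 (by decide) hβ' (by simp only [θ]; push_cast; field_simp) FT
    rw [ev_zero β 0 (by simp) _ (by decide +kernel : lzero 0 (lhorn t0 Nth 300 FT) = true)] at h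
    rcases mul_eq_zero.1 h.symm with h | h
    · exact absurd h (pow_ne_zero _ (by norm_num))
    · exact h
  let t : 𝓞 K := ⟨θ, ev_integral θ FT_eq hθ⟩
  have ht : ev t FT = 0 := by
    apply RingOfIntegers.coe_injective
    rw [map_ev, map_zero]; exact hθ
  obtain ⟨A, hA, -⟩ := det_idx K hK 16 F0 t0
    [-96,159,-115,195,-546,1031,-1269,945,-410,69,21,1] rfl rfl rfl irrF0 b hβ
  obtain ⟨B, hB, hB'⟩ := det_idx K hK (-3673) FT tT
    [-1623,37836,-49905,25320,-7149,2826,-1197,270,-55,12,-3,1] rfl rfl rfl irrFT t hθ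
  rw [det0] at hA
  rw [detT] at hB
  have : Fact (Nat.Prime 5) := ⟨by norm_num⟩
  have : Fact (Nat.Prime 7) := ⟨by norm_num⟩
  have n3 : ¬ (((3 : ℕ) : ℤ) ∣ B.det) := ded_ndvd rfl ded3 FT_eq rfl irrFT t ht B hB'
  have n5 : ¬ (((5 : ℕ) : ℤ) ∣ B.det) := ded_ndvd rfl ded5 FT_eq rfl irrFT t ht B hB'
  have n7 : ¬ (((7 : ℕ) : ℤ) ∣ B.det) := ded_ndvd rfl ded7 FT_eq rfl irrFT t ht B hB'
  exact arith A.det B.det (discr K) hA hB (two_dvd t ht B hB')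
    n3
    n5
    n7
    (disc_two t ht (dvd_of_root FT_eq irrFT t ht))

end M11
theorem m11_field_disc_2357 :
    Irreducible f2 ∧
    IsSimpleGroup f2.Gal ∧ Nat.card f2.Gal = 7920 ∧
    ∀ (K : Type) [Field K] [NumberField K],
      Nonempty (AdjoinRoot f2 ≃ₐ[ℚ] K) →
      Module.finrank ℚ K = 12 ∧
      NumberField.discr K = 2 ^ 8 * 3 ^ 16 * 5 ^ 10 * 7 ^ 4 :=
  ⟨M11.f2_irr, M11.gal_concl.2, M11.gal_concl.1, fun K _ _ ⟨e⟩ => M11.fieldK K e⟩
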